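/- arXiv:2010.05368 — 5 statements merged into one kernel-verified Lean document; each statement's English description precedes it below -/
import Mathlib

section
/- Let 𝔦 be a nonempty finite index set, and for each i ∈ 𝔦 let X_i ⊆ ℝ^{d_i} be nonempty and compact; set X = ∏_{i∈𝔦} X_i. Let Y ⊆ ℝ^p be nonempty and compact, S : X ⇉ Y a set-valued map with nonempty Borel-measurable values, and for each i let θ_i : X × Y → ℝ be continuous and β^i : X → 𝒫(Y) a weak continuous belief over S. Then each value function φ_i(x) = ∫_Y θ_i(x,y) dβ^i_x(y) is continuous on X, and there exists a mixed equilibrium: a family (ν_i)_{i∈𝔦} with ν_i a Borel probability measure on X_i such that for every i ∈ 𝔦 and every Borel probability measure ν on X_i, ∫_{X_i} ∫_{X_{-i}} φ_i(x_i,x_{-i}) dν_{-i}(x_{-i}) dν_i(x_i) ≤ ∫_{X_i} ∫_{X_{-i}} φ_i(x_i,x_{-i}) dν_{-i}(x_{-i}) dν(x_i), where ν_{-i} = ⊗_{j≠i} ν_j is the product measure on X_{-i} = ∏_{j≠i} X_j. -/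
open MeasureTheory Filter Topology Set
open scoped ENNReal

/-- Combine the decision `xi` of player `i` with the decisions `xm` of the other
players into a full strategy profile. -/
noncomputable def combineProfile {ι : Type} [DecidableEq ι] (dm : ι → ℕ) (i : ι)
    (xi : EuclideanSpace ℝ (Fin (dm i)))
    (xm : ∀ j : {j : ι // j ≠ i}, EuclideanSpace ℝ (Fin (dm j.1))) :
    ∀ j, EuclideanSpace ℝ (Fin (dm j)) :=
  fun j =>
    if h : j = i then cast (congrArg (fun t => EuclideanSpace ℝ (Fin (dm t))) h).symm xi
    else xm ⟨j, h⟩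

/-- A finite set `R` is dominant for a family of preference functions `r i` if no point is
strictly above the `r i`-minimum of `R` for every index `i`. -/
def IsDominantFor {ι V : Type*} (r : ι → V → ℕ) (R : Finset V) : Prop :=
  ∀ y, ∃ i, ∀ x ∈ R, r i y ≤ r i x

theorem IsDominantFor.mono {ι V : Type*} {r : ι → V → ℕ} {R d : Finset V}
    (h : IsDominantFor r R) (hd : d ⊆ R) : IsDominantFor r d := fun y =>
  let ⟨i, hi⟩ := h y
  ⟨i, fun x hx => hi x (hd hx)⟩

/-- A dominant set with one element less than the index set, above which each relaxed set of
constraints is feasible, has exactly two dominant one-point extensions. -/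
theorem IsDominantFor.exists_two_extensions {ι V : Type*} [Fintype ι] [DecidableEq ι]
    [Nontrivial ι] [Finite V] [DecidableEq V] {r : ι → V → ℕ}
    (hr : ∀ i, Function.Injective (r i)) {d : Finset V} (hd : IsDominantFor r d)
    (hcard : d.card + 1 = Fintype.card ι)
    (hM : ∀ k, ∃ y, ∀ l ≠ k, ∃ x ∈ d, r l x < r l y) :
    ∃ x y, x ∉ d ∧ y ∉ d ∧ x ≠ y ∧
      ∀ z ∉ d, (IsDominantFor r (insert z d) ↔ z = x ∨ z = y) := by
  have hι : 1 < Fintype.card ι := Fintype.one_lt_card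
  have hne : d.Nonempty := Finset.card_pos.1 (by omega)
  choose a had hamin using fun i => Finset.exists_min_image d (r i) hne
  have hsurj : ∀ x ∈ d, ∃ i, a i = x := fun x hx => by
    obtain ⟨i, hi⟩ := hd x
    exact ⟨i, hr i (le_antisymm (hamin i x hx) (hi _ (had i)))⟩
  -- covering `d` by the minima of all indices but `k` forces injectivity off `k`
  have hinj : ∀ k, (∀ x ∈ d, ∃ i, i ≠ k ∧ a i = x) →
      ∀ l ≠ k, ∀ m ≠ k, a l = a m → l = m := by
    intro k hk l hl m hm hlm
    have himg : (Finset.univ.erase k).image a = d := by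
      ext x
      simp only [Finset.mem_image, Finset.mem_erase, Finset.mem_univ, and_true]
      exact ⟨fun ⟨i, _, hi⟩ => hi ▸ had i, hk x⟩
    have := Finset.card_image_iff.1
      (show ((Finset.univ.erase k).image a).card = (Finset.univ.erase k).card by
        rw [himg, Finset.card_erase_of_mem (Finset.mem_univ k), Finset.card_univ]; omega)
    exact this (by simpa using hl) (by simpa using hm) hlm
  obtain ⟨i, j, hij, haij⟩ : ∃ i j, i ≠ j ∧ a i = a j := by
    by_contra! h
    have hinja : Function.Injective a := fun x y hxy => by
      by_contra hne; exact h x y hne hxy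
    have := Finset.card_le_card_of_injOn (s := Finset.univ) (t := d) a (fun x _ => had x)
      hinja.injOn
    rw [Finset.card_univ] at this
    omega
  have hcoll : ∀ k, (∀ x ∈ d, ∃ i, i ≠ k ∧ a i = x) → k = i ∨ k = j := by
    intro k hk
    by_contra! h
    exact hij (hinj k hk i h.1.symm j h.2.symm haij)
  let M : ι → V → Prop := fun k y => ∀ l ≠ k, r l (a l) < r l y
  have hMex : ∀ k, ∃ x, M k x ∧ ∀ y, M k y → r k y ≤ r k x := by
    intro k
    have hne : {y | M k y}.Nonempty := by
      obtain ⟨y, hy⟩ := hM k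
      refine ⟨y, fun l hl => ?_⟩
      obtain ⟨x, hx, hxy⟩ := hy l hl
      exact (hamin l x hx).trans_lt hxy
    exact Set.exists_max_image _ (r k) (Set.toFinite _) hne
  choose b hbM hbmax using hMex
  have hMd : ∀ k k' y, k ≠ k' → a k = a k' → M k y → y ∉ d := by
    intro k k' y hkk ha hy hyd
    obtain ⟨m, rfl⟩ := hsurj y hyd
    rcases eq_or_ne m k with rfl | hm
    · exact lt_irrefl _ (ha ▸ hy k' hkk.symm)
    · exact lt_irrefl _ (hy m hm)
  have hMdisj : ∀ k k' y, k ≠ k' → M k y → ¬ M k' y := by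
    intro k k' y hkk hy hy'
    obtain ⟨l, hl⟩ := hd y
    rcases eq_or_ne l k with rfl | hlk
    · exact absurd (hl _ (had l)) (not_le.2 (hy' l hkk))
    · exact absurd (hl _ (had l)) (not_le.2 (hy l hlk))
  have hdom : ∀ k, IsDominantFor r (insert (b k) d) := by
    intro k y
    by_cases hy : M k y
    · obtain ⟨l, hl⟩ := hd y
      obtain rfl : l = k := by
        by_contra hlk
        exact absurd (hl _ (had l)) (not_le.2 (hy l hlk))
      refine ⟨l, fun x hx => ?_⟩
      rcases Finset.mem_insert.1 hx with rfl | hx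
      · exact hbmax l y hy
      · exact hl x hx
    · simp only [M, not_forall, not_lt] at hy
      obtain ⟨l, hl, hy⟩ := hy
      refine ⟨l, fun x hx => ?_⟩
      rcases Finset.mem_insert.1 hx with rfl | hx
      · exact hy.trans (hbM k l hl).le
      · exact hy.trans (hamin l x hx)
  refine ⟨b i, b j, hMd i j _ hij haij (hbM i), hMd j i _ hij.symm haij.symm (hbM j),
    fun h => hMdisj i j _ hij (hbM i) (h ▸ hbM j), fun z hz => ⟨fun hR => ?_, ?_⟩⟩
  · obtain ⟨k, hk⟩ := hR z
    have hcover : ∀ x ∈ d, ∃ l, (l ≠ k ∧ a l = x) ∧ r l x ≤ r l z := by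
      intro x hx
      obtain ⟨l, hl⟩ := hR x
      have hlx : a l = x :=
        hr l (le_antisymm (hamin l x hx) (hl _ (Finset.mem_insert_of_mem (had l))))
      have hxz := hl z (Finset.mem_insert_self _ _)
      refine ⟨l, ⟨?_, hlx⟩, hxz⟩
      rintro rfl
      exact hz (hr l (le_antisymm hxz (hk x (Finset.mem_insert_of_mem hx))) ▸ hx)
    have hcover' : ∀ x ∈ d, ∃ l, l ≠ k ∧ a l = x := fun x hx =>
      let ⟨l, hl, _⟩ := hcover x hx
      ⟨l, hl⟩
    have hzM : M k z := by
      intro l hl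
      obtain ⟨l', ⟨hl', hal⟩, hle⟩ := hcover (a l) (had l)
      obtain rfl := hinj k hcover' l' hl' l hl hal
      exact lt_of_le_of_ne hle fun h => hz (hr l' h ▸ had l')
    have hzb : z = b k := by
      refine hr k (le_antisymm (hbmax k z hzM) ?_)
      obtain ⟨m, hm⟩ := hR (b k)
      obtain rfl : m = k := by
        by_contra hmk
        exact absurd (hm _ (Finset.mem_insert_of_mem (had m))) (not_le.2 (hbM k m hmk))
      exact hm z (Finset.mem_insert_self _ _)
    rcases hcoll k hcover' with rfl | rfl
    · exact Or.inl hzb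
    · exact Or.inr hzb
  · rintro (rfl | rfl) <;> exact hdom _

/-- If no point of `R` carries all the labels, the number of facets of `R` carrying all labels
but `i₀` is even. -/
theorem even_card_filter_image_erase {ι V : Type*} [Fintype ι] [DecidableEq ι] [DecidableEq V]
    (c : V → ι) (i₀ : ι) {R : Finset V} (hcard : R.card = Fintype.card ι)
    (hR : R.image c ≠ Finset.univ) :
    Even (R.filter fun x => (R.erase x).image c = Finset.univ.erase i₀).card := by
  by_cases hex : ∃ x ∈ R, (R.erase x).image c = Finset.univ.erase i₀
  swap
  · rw [Finset.filter_eq_empty_iff.2 fun x hx h => hex ⟨x, hx, h⟩]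
    simp
  obtain ⟨x, hx, hxc⟩ := hex
  have hinj : Set.InjOn c (R.erase x) := Finset.card_image_iff.1 <| by
    rw [hxc, Finset.card_erase_of_mem (Finset.mem_univ _), Finset.card_erase_of_mem hx, hcard,
      Finset.card_univ]
  have hi₀ : ∀ y ∈ R, c y ≠ i₀ := by
    intro y hy hyi
    apply hR
    ext q
    simp only [Finset.mem_univ, iff_true, Finset.mem_image]
    rcases eq_or_ne q i₀ with rfl | hq
    · exact ⟨y, hy, hyi⟩
    · have : q ∈ (R.erase x).image c := by rw [hxc]; simp [hq]
      obtain ⟨z, hz, hzq⟩ := Finset.mem_image.1 this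
      exact ⟨z, Finset.mem_of_mem_erase hz, hzq⟩
  have hq : ∀ q ≠ i₀, ∃ z ∈ R.erase x, c z = q := fun q hq => by
    have : q ∈ (R.erase x).image c := by rw [hxc]; simp [hq]
    exact Finset.mem_image.1 this
  obtain ⟨x', hx', hcx⟩ := hq (c x) (hi₀ x hx)
  have hxx : x ≠ x' := fun h => by simp [h] at hx'
  have hx'R := Finset.mem_of_mem_erase hx'
  have : (R.filter fun x => (R.erase x).image c = Finset.univ.erase i₀) = {x, x'} := by
    ext y
    simp only [Finset.mem_filter, Finset.mem_insert, Finset.mem_singleton]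
    constructor
    · rintro ⟨hy, hyc⟩
      by_contra! hne
      have : c y ∈ (R.erase y).image c := by rw [hyc]; simp [hi₀ y hy]
      obtain ⟨z, hz, hzy⟩ := Finset.mem_image.1 this
      obtain ⟨hzne, hzR⟩ := Finset.mem_erase.1 hz
      have hyx : y ∈ R.erase x := Finset.mem_erase.2 ⟨hne.1, hy⟩
      rcases eq_or_ne z x with rfl | hzx
      · exact hne.2 (hinj hyx hx' (hzy.symm.trans hcx.symm))
      · exact hzne (hinj (Finset.mem_coe.2 (Finset.mem_erase.2 ⟨hzx, hzR⟩)) hyx hzy)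
    · rintro (rfl | rfl)
      · exact ⟨hx, hxc⟩
      · refine ⟨hx'R, ?_⟩
        ext q
        simp only [Finset.mem_image, Finset.mem_erase, Finset.mem_univ, and_true]
        constructor
        · rintro ⟨z, ⟨_, hz⟩, rfl⟩
          exact hi₀ z hz
        · intro hqi
          obtain ⟨z, hz, hzq⟩ := hq q hqi
          rcases eq_or_ne z y with rfl | hzy
          · exact ⟨x, ⟨hxx, hx⟩, hcx ▸ hzq⟩
          · exact ⟨z, ⟨hzy, Finset.mem_of_mem_erase hz⟩, hzq⟩
  rw [this, Finset.card_pair hxx]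
  exact even_two

/-- Parity argument behind Scarf's theorem. -/
theorem exists_isDominantFor_image_eq_univ {ι V : Type*} [Fintype ι] [DecidableEq ι]
    [Nontrivial ι] [Finite V] [DecidableEq V] {r : ι → V → ℕ}
    (hr : ∀ i, Function.Injective (r i)) (c : V → ι) {i₀ : ι} {d₀ : Finset V}
    (hd₀ : IsDominantFor r d₀) (hcard₀ : d₀.card + 1 = Fintype.card ι)
    (hc₀ : d₀.image c = Finset.univ.erase i₀)
    (hext₀ : ∃ x ∉ d₀, ∀ z ∉ d₀, (IsDominantFor r (insert z d₀) ↔ z = x))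
    (hM : ∀ d : Finset V, d ≠ d₀ → d.card + 1 = Fintype.card ι → d.image c = Finset.univ.erase i₀ →
      ∀ k, ∃ y, ∀ l ≠ k, ∃ x ∈ d, r l x < r l y) :
    ∃ R, IsDominantFor r R ∧ R.image c = Finset.univ := by
  classical
  have := Fintype.ofFinite V
  by_contra! hno
  let rooms : Finset (Finset V) :=
    Finset.univ.filter fun R => R.card = Fintype.card ι ∧ IsDominantFor r R
  let doors : Finset (Finset V) := Finset.univ.filter fun d =>
    d.card + 1 = Fintype.card ι ∧ IsDominantFor r d ∧ d.image c = Finset.univ.erase i₀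
  have hcount := Finset.sum_card_bipartiteAbove_eq_sum_card_bipartiteBelow
    (s := doors) (t := rooms) (fun d R => d ⊆ R)
  have hrooms : ∀ R ∈ rooms, Even (doors.bipartiteBelow (fun d R => d ⊆ R) R).card := by
    intro R hR
    simp only [rooms, Finset.mem_filter, Finset.mem_univ, true_and] at hR
    have := even_card_filter_image_erase c i₀ hR.1 (hno R hR.2)
    rw [← Finset.card_image_of_injOn (f := fun x => R.erase x)] at this
    · convert this using 2
      ext d
      simp only [Finset.mem_bipartiteBelow, doors, Finset.mem_filter, Finset.mem_univ, true_and,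
        Finset.mem_image]
      constructor
      · rintro ⟨⟨hdc, -, hdi⟩, hdR⟩
        obtain ⟨x, hx⟩ := Finset.card_eq_one.1
          (show (R \ d).card = 1 by rw [Finset.card_sdiff_of_subset hdR]; omega)
        have hxR : x ∈ R \ d := by rw [hx]; exact Finset.mem_singleton_self x
        have : R.erase x = d := by
          rw [← Finset.sdiff_singleton_eq_erase, ← hx, Finset.sdiff_sdiff_eq_self hdR]
        exact ⟨x, ⟨(Finset.mem_sdiff.1 hxR).1, this ▸ hdi⟩, this⟩
      · rintro ⟨x, ⟨hx, hxc⟩, rfl⟩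
        refine ⟨⟨?_, hR.2.mono (Finset.erase_subset _ _), hxc⟩, Finset.erase_subset _ _⟩
        rw [Finset.card_erase_add_one hx, hR.1]
    · intro x hx y hy hxy
      by_contra hne
      have : x ∈ R.erase y := Finset.mem_erase.2 ⟨hne, (Finset.mem_filter.1 hx).1⟩
      rw [← show R.erase x = R.erase y from hxy] at this
      simp at this
  have habove : ∀ d, d.card + 1 = Fintype.card ι → ∀ s : Finset V, (∀ z ∈ s, z ∉ d) →
      (∀ z ∉ d, (IsDominantFor r (insert z d) ↔ z ∈ s)) →
      (rooms.bipartiteAbove (fun d R => d ⊆ R) d).card = s.card := by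
    intro d hdc s hs hsd
    rw [← Finset.card_image_of_injOn (s := s) (f := fun z => insert z d)]
    · congr 1
      ext R
      simp only [Finset.mem_bipartiteAbove, rooms, Finset.mem_filter, Finset.mem_univ, true_and,
        Finset.mem_image]
      constructor
      · rintro ⟨⟨hRc, hR⟩, hdR⟩
        obtain ⟨x, hx⟩ := Finset.card_eq_one.1
          (show (R \ d).card = 1 by rw [Finset.card_sdiff_of_subset hdR]; omega)
        have hxR : x ∈ R \ d := by rw [hx]; exact Finset.mem_singleton_self x
        have : insert x d = R := by
          rw [Finset.insert_eq, ← hx, Finset.sdiff_union_of_subset hdR]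
        exact ⟨x, (hsd x (Finset.mem_sdiff.1 hxR).2).1 (this ▸ hR), this⟩
      · rintro ⟨z, hz, rfl⟩
        refine ⟨⟨?_, (hsd z (hs z hz)).2 hz⟩, Finset.subset_insert _ _⟩
        rw [Finset.card_insert_of_notMem (hs z hz), hdc]
    · intro x hx y hy hxy
      have : x ∈ insert y d := by
        rw [← show insert x d = insert y d from hxy]; exact Finset.mem_insert_self _ _
      exact (Finset.mem_insert.1 this).resolve_right (hs x hx)
  have hd₀mem : d₀ ∈ doors := by
    simp only [doors, Finset.mem_filter, Finset.mem_univ, true_and]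
    exact ⟨hcard₀, hd₀, hc₀⟩
  rw [← Finset.sum_erase_add _ _ hd₀mem] at hcount
  have hone : (rooms.bipartiteAbove (fun d R => d ⊆ R) d₀).card = 1 := by
    obtain ⟨x, hx, hx'⟩ := hext₀
    rw [habove d₀ hcard₀ {x} (by simpa using hx) (by simpa using hx'), Finset.card_singleton]
  have heven : Even (∑ d ∈ doors.erase d₀,
      (rooms.bipartiteAbove (fun d R => d ⊆ R) d).card) := by
    refine Finset.even_sum _ fun d hd => ?_
    obtain ⟨hne, hd⟩ := Finset.mem_erase.1 hd
    simp only [doors, Finset.mem_filter, Finset.mem_univ, true_and] at hd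
    obtain ⟨x, y, hx, hy, hxy, h⟩ :=
      hd.2.1.exists_two_extensions hr hd.1 (hM d hne hd.1 hd.2.2)
    rw [habove d hd.1 {x, y} (by simpa using ⟨hx, hy⟩) (by simpa using h),
      Finset.card_pair hxy]
    exact even_two
  have heven' := Finset.even_sum _ hrooms
  rw [← hcount, hone] at heven'
  exact (Nat.even_add_one.1 heven') heven

/-- **Scarf's theorem** on dominant sets: given injective rankings `r i` of a finite nonempty
set `T` and a labelling of `T` by the index set, there are a set `C` of indices and
points of `T` carrying exactly these labels, with no point of `T` strictly above all their
minima. -/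
theorem scarf_dominant {ι T : Type*} [Fintype ι] [Nontrivial ι] [Finite T] [Nonempty T]
    {r : ι → T → ℕ} (hr : ∀ i, Function.Injective (r i)) (c : T → ι) :
    ∃ (σ : Set T) (C : Finset ι), (∀ i ∈ C, ∃ t ∈ σ, c t = i) ∧
      ∀ y, ∃ i ∈ C, ∀ x ∈ σ, r i y ≤ r i x := by
  classical
  have := Fintype.ofFinite T
  obtain ⟨i₀⟩ : Nonempty ι := inferInstance
  let e := Fintype.equivFin ι
  let B : ℕ := ∑ i, ∑ t, (r i t + 1)
  have hB : ∀ i t, r i t + 1 ≤ B := fun i t =>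
    (Finset.single_le_sum (f := fun t => r i t + 1) (fun _ _ => Nat.zero_le _)
      (Finset.mem_univ t)).trans
    (Finset.single_le_sum (f := fun i => ∑ t, (r i t + 1)) (fun _ _ => Nat.zero_le _)
      (Finset.mem_univ i))
  let s : ι → T ⊕ ι → ℕ := fun i => Sum.elim (fun t => r i t + 1)
    fun j => if j = i then 0 else B + 1 + e j
  have hs_self : ∀ i, s i (Sum.inr i) = 0 := fun i => by simp [s]
  have hs_ne : ∀ i j, j ≠ i → s i (Sum.inr j) = B + 1 + e j := fun i j h => by simp [s, h]
  have hs_inl : ∀ i t, s i (Sum.inl t) = r i t + 1 := fun i t => rfl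
  have hlt : ∀ i j t, j ≠ i → s i (Sum.inl t) < s i (Sum.inr j) := fun i j t h => by
    rw [hs_ne i j h, hs_inl]; have := hB i t; omega
  have hs : ∀ i, Function.Injective (s i) := by
    intro i
    rintro (t | j) (t' | j') h
    · rw [hs_inl, hs_inl] at h
      rw [hr i (Nat.succ_injective h)]
    · exfalso
      rcases eq_or_ne j' i with rfl | hj
      · rw [hs_self, hs_inl] at h; omega
      · exact (hlt i j' t hj).ne h
    · exfalso
      rcases eq_or_ne j i with rfl | hj
      · rw [hs_self, hs_inl] at h; omega
      · exact (hlt i j t' hj).ne' h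
    · rcases eq_or_ne j i with hj | hj <;> rcases eq_or_ne j' i with hj' | hj'
      · rw [hj, hj']
      · rw [hj, hs_self, hs_ne _ _ hj'] at h; omega
      · rw [hj', hs_self, hs_ne _ _ hj] at h; omega
      · rw [hs_ne _ _ hj, hs_ne _ _ hj'] at h
        have : e j = e j' := Fin.ext (by omega)
        rw [e.injective this]
  let outer : ι → Finset (T ⊕ ι) := fun i => (Finset.univ.erase i).image Sum.inr
  have hmem : ∀ i v, v ∈ outer i ↔ ∃ l ≠ i, Sum.inr l = v := fun i v => by simp [outer]
  have houter : ∀ i, (outer i).card + 1 = Fintype.card ι := fun i => by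
    rw [Finset.card_image_of_injective _ Sum.inr_injective,
      Finset.card_erase_add_one (Finset.mem_univ _), Finset.card_univ]
  have himg : ∀ i, (outer i).image (Sum.elim c id) = Finset.univ.erase i := fun i => by
    rw [Finset.image_image]
    exact Finset.image_id
  obtain ⟨t₁, ht₁⟩ := Finite.exists_max (r i₀)
  obtain ⟨R, hR, hRc⟩ := exists_isDominantFor_image_eq_univ hs (Sum.elim c id)
    (d₀ := outer i₀) (i₀ := i₀) (by
      intro y
      rcases y with t | l
      · refine ⟨i₀, fun x hx => ?_⟩
        obtain ⟨m, hm, rfl⟩ := (hmem _ _).1 hx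
        exact (hlt _ _ _ hm).le
      · exact ⟨l, fun x _ => by rw [hs_self]; exact Nat.zero_le _⟩)
    (houter i₀) (himg i₀) (by
      refine ⟨Sum.inl t₁, by simp [outer], fun z hz => ⟨fun h => ?_, ?_⟩⟩
      · rcases z with t | l
        · obtain ⟨i, hi⟩ := h (Sum.inl t₁)
          rcases eq_or_ne i i₀ with rfl | hi₀
          · have := hi _ (Finset.mem_insert_self _ _)
            rw [hs_inl, hs_inl] at this
            rw [hr i (le_antisymm (ht₁ t) (Nat.le_of_succ_le_succ this))]
          · have := hi _ (Finset.mem_insert_of_mem ((hmem _ _).2 ⟨i, hi₀, rfl⟩))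
            rw [hs_self, hs_inl] at this
            omega
        · obtain rfl : l = i₀ := by
            by_contra hl
            exact hz ((hmem _ _).2 ⟨l, hl, rfl⟩)
          obtain ⟨i, hi⟩ := h (Sum.inl t₁)
          have := hi (Sum.inr i) (by
            rcases eq_or_ne i l with rfl | hil
            · exact Finset.mem_insert_self _ _
            · exact Finset.mem_insert_of_mem ((hmem _ _).2 ⟨i, hil, rfl⟩))
          rw [hs_self, hs_inl] at this
          omega
      · rintro rfl y
        rcases y with t | l
        · refine ⟨i₀, fun x hx => ?_⟩
          rcases Finset.mem_insert.1 hx with rfl | hx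
          · rw [hs_inl, hs_inl]
            exact Nat.succ_le_succ (ht₁ t)
          · obtain ⟨m, hm, rfl⟩ := (hmem _ _).1 hx
            exact (hlt _ _ _ hm).le
        · exact ⟨l, fun x _ => by rw [hs_self]; exact Nat.zero_le _⟩)
    (by
      intro d hd hdc hdi k
      refine ⟨Sum.inr k, fun l hl => ?_⟩
      have hsub : ¬ d ⊆ outer l := by
        intro hsub
        have hdl : d = outer l :=
          Finset.eq_of_subset_of_card_le hsub (by have := houter l; omega)
        rw [hdl, himg] at hdi
        have : l = i₀ := by
          by_contra hne
          have : l ∈ Finset.univ.erase i₀ := by simp [hne]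
          rw [← hdi] at this
          simp at this
        exact hd (this ▸ hdl)
      obtain ⟨v, hv, hvl⟩ := Finset.not_subset.1 hsub
      refine ⟨v, hv, ?_⟩
      rcases v with t | m
      · exact hlt _ _ _ hl.symm
      · obtain rfl : m = l := by
          by_contra hm
          exact hvl ((hmem _ _).2 ⟨m, hm, rfl⟩)
        rw [hs_self, hs_ne _ _ hl.symm]
        omega)
  refine ⟨{t | Sum.inl t ∈ R}, Finset.univ.filter fun i => Sum.inr i ∉ R, fun i hi => ?_,
    fun y => ?_⟩
  · have : i ∈ R.image (Sum.elim c id) := by rw [hRc]; exact Finset.mem_univ i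
    obtain ⟨t | j, hv, hvi⟩ := Finset.mem_image.1 this
    · exact ⟨t, hv, hvi⟩
    · obtain rfl : j = i := hvi
      exact absurd hv (Finset.mem_filter.1 hi).2
  · obtain ⟨i, hi⟩ := hR (Sum.inl y)
    refine ⟨i, Finset.mem_filter.2 ⟨Finset.mem_univ i, fun hmemR => ?_⟩, fun x hx => ?_⟩
    · have := hi _ hmemR
      rw [hs_self, hs_inl] at this
      omega
    · have := hi _ hx
      rw [hs_inl, hs_inl] at this
      omega

/-- The combinatorial core of the simplex argument: integer points of the dilated simplex with
labels in `C` cluster around a face spanned by `C`. -/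
theorem exists_cluster_of_labelling {ι : Type*} [Fintype ι] [Nontrivial ι] (N : ℕ)
    (c : (ι → ℕ) → ι) :
    ∃ t : ι → ℕ, ∑ i, t i = N ∧ ∀ i, t i < Fintype.card ι ∨
      ∃ u : ι → ℕ, ∑ i, u i = N ∧ c u = i ∧
        ∀ j, t j < u j + Fintype.card ι ∧ u j < t j + Fintype.card ι := by
  classical
  let T := {t : ι → ℕ // ∑ i, t i = N}
  have hT : {t : ι → ℕ | ∑ i, t i = N}.Finite := by
    refine (Finset.finite_toSet (Finset.piAntidiag Finset.univ N)).subset fun t ht => ?_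
    simpa [Finset.mem_piAntidiag] using ht
  have hfin : Finite T := hT
  have := Fintype.ofFinite T
  obtain ⟨i₁⟩ : Nonempty ι := inferInstance
  have hne : Nonempty T := ⟨⟨Pi.single i₁ N, by simp⟩⟩
  let e := Fintype.equivFin T
  let M := Fintype.card T
  let r : ι → T → ℕ := fun i t => t.1 i * M + e t
  have hr_le : ∀ i t u, r i t ≤ r i u → t.1 i ≤ u.1 i := by
    intro i t u h
    by_contra! hlt
    have h1 : (u.1 i + 1) * M ≤ t.1 i * M := Nat.mul_le_mul_right _ hlt
    have h2 := (e u).2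
    simp only [r] at h
    rw [add_mul, one_mul] at h1
    omega
  have hr : ∀ i, Function.Injective (r i) := by
    intro i t u h
    have h1 := le_antisymm (hr_le i t u h.le) (hr_le i u t h.ge)
    simp only [r, h1] at h
    exact e.injective (Fin.ext (by omega))
  obtain ⟨σ, C, hC, hdom⟩ := scarf_dominant hr fun t => c t.1
  obtain ⟨i₀, hi₀, -⟩ := hdom hne.some
  obtain ⟨t₀, ht₀, -⟩ := hC i₀ hi₀
  have hmin : ∀ i, ∃ x ∈ σ, ∀ y ∈ σ, x.1 i ≤ y.1 i := fun i =>
    Set.exists_min_image σ (fun x => x.1 i) (Set.toFinite _) ⟨t₀, ht₀⟩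
  choose m hmσ hm using hmin
  have hsum : N < ∑ i ∈ C, ((m i).1 i + 1) := by
    by_contra! hle
    obtain ⟨k, hk⟩ := Nat.exists_eq_add_of_le hle
    let y : ι → ℕ := fun i => (if i ∈ C then (m i).1 i + 1 else 0) +
      (Pi.single i₀ k : ι → ℕ) i
    have hy : ∑ i, y i = N := by
      rw [Finset.sum_add_distrib, ← Finset.sum_filter, Finset.filter_mem_eq_inter,
        Finset.univ_inter, Finset.sum_pi_single', if_pos (Finset.mem_univ _)]
      exact hk.symm
    obtain ⟨i, hi, h⟩ := hdom ⟨y, hy⟩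
    have := hr_le _ _ _ (h _ (hmσ i))
    simp only [y, hi, if_true] at this
    omega
  rw [Finset.sum_add_distrib, Finset.sum_const, smul_eq_mul, mul_one] at hsum
  have hCcard : C.card ≤ Fintype.card ι := Finset.card_le_univ C
  have hsplit : ∀ x : T, ∑ i ∈ C, x.1 i + ∑ i ∈ Cᶜ, x.1 i = N := fun x => by
    rw [Finset.sum_add_sum_compl]; exact x.2
  have hin : ∀ x ∈ σ, ∀ i ∈ C, x.1 i < (m i).1 i + Fintype.card ι := by
    intro x hx i hi
    have h1 : ∑ j ∈ C.erase i, (m j).1 j ≤ ∑ j ∈ C.erase i, x.1 j :=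
      Finset.sum_le_sum fun j _ => hm j x hx
    have h2 := Finset.sum_erase_add C (fun j => (m j).1 j) hi
    have h3 := Finset.sum_erase_add C (fun j => x.1 j) hi
    have h4 := hsplit x
    omega
  have hout : ∀ x ∈ σ, ∀ i ∉ C, x.1 i < Fintype.card ι := by
    intro x hx i hi
    have h1 : ∑ j ∈ C, (m j).1 j ≤ ∑ j ∈ C, x.1 j :=
      Finset.sum_le_sum fun j _ => hm j x hx
    have h2 : x.1 i ≤ ∑ i ∈ Cᶜ, x.1 i :=
      Finset.single_le_sum (f := fun i => x.1 i) (fun _ _ => Nat.zero_le _)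
        (Finset.mem_compl.2 hi)
    have h4 := hsplit x
    omega
  refine ⟨t₀.1, t₀.2, fun i => ?_⟩
  by_cases hi : i ∈ C
  · obtain ⟨u, hu, hui⟩ := hC i hi
    refine Or.inr ⟨u.1, u.2, hui, fun j => ?_⟩
    by_cases hj : j ∈ C
    · have h1 := hin _ ht₀ j hj
      have h2 := hin _ hu j hj
      have h3 := hm j _ ht₀
      have h4 := hm j _ hu
      omega
    · have h1 := hout _ ht₀ j hj
      have h2 := hout _ hu j hj
      omega
  · exact Or.inl (hout _ ht₀ i hi)

/-- A form of **Brouwer's fixed point theorem** on the simplex: a nonnegative continuous vector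
field is, at some point of the simplex, dominating its own projection on that point. -/
theorem exists_mul_sum_le_of_continuousOn_stdSimplex {ι : Type*} [Fintype ι] [Nonempty ι]
    {h : (ι → ℝ) → ι → ℝ} (hcont : ContinuousOn h (stdSimplex ℝ ι))
    (hpos : ∀ x ∈ stdSimplex ℝ ι, ∀ i, 0 ≤ h x i) :
    ∃ x ∈ stdSimplex ℝ ι, ∀ i, x i * ∑ j, h x j ≤ h x i := by
  classical
  have hexists : ∀ x ∈ stdSimplex ℝ ι, ∃ i, x i * ∑ j, h x j ≤ h x i := by
    intro x hx
    by_contra! hlt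
    have := Finset.sum_lt_sum_of_nonempty Finset.univ_nonempty fun i _ => hlt i
    rw [← Finset.sum_mul, hx.2, one_mul] at this
    exact lt_irrefl _ this
  rcases subsingleton_or_nontrivial ι with hsub | hnt
  · obtain ⟨x, hx⟩ : (stdSimplex ℝ ι).Nonempty :=
      ⟨Pi.single (Classical.arbitrary ι) 1, single_mem_stdSimplex ℝ _⟩
    obtain ⟨i, hi⟩ := hexists x hx
    exact ⟨x, hx, fun j => Subsingleton.elim i j ▸ hi⟩
  let n := Fintype.card ι
  let scale : ℕ → (ι → ℕ) → ι → ℝ := fun N t i => (t i : ℝ) / ((N : ℝ) + 1)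
  have hscale : ∀ N t, ∑ i, t i = N + 1 → scale N t ∈ stdSimplex ℝ ι := by
    intro N t ht
    refine ⟨fun i => by positivity, ?_⟩
    rw [← Finset.sum_div, ← Nat.cast_sum, ht]
    push_cast
    exact div_self (by positivity)
  have hlabel : ∀ N t, ∃ i, ∑ i, t i = N + 1 →
      scale N t i * ∑ j, h (scale N t) j ≤ h (scale N t) i := by
    intro N t
    by_cases ht : ∑ i, t i = N + 1
    · obtain ⟨i, hi⟩ := hexists _ (hscale N t ht)
      exact ⟨i, fun _ => hi⟩
    · exact ⟨Classical.arbitrary ι, fun h => absurd h ht⟩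
  choose c hc using hlabel
  choose t ht htc using fun N => exists_cluster_of_labelling (N + 1) (c N)
  obtain ⟨x, hx, φ, hφ, hlim⟩ := (isCompact_stdSimplex ℝ ι).tendsto_subseq
    fun N => hscale N (t N) (ht N)
  refine ⟨x, hx, fun i => ?_⟩
  by_contra! hlt
  have hxi : 0 < x i := by
    rcases (hx.1 i).eq_or_lt with h0 | h0
    · rw [← h0, zero_mul] at hlt
      exact absurd (hpos x hx i) (not_le.2 hlt)
    · exact h0
  have hnear : ∀ᶠ y in 𝓝[stdSimplex ℝ ι] x, h y i < y i * ∑ j, h y j := by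
    have h1 : ContinuousWithinAt (fun y => h y i) (stdSimplex ℝ ι) x :=
      (continuousOn_pi.1 hcont i) x hx
    have h2 : ContinuousWithinAt (fun y => y i * ∑ j, h y j) (stdSimplex ℝ ι) x :=
      (continuous_apply i).continuousWithinAt.mul
        (tendsto_finsetSum _ fun j _ => (continuousOn_pi.1 hcont j) x hx)
    exact h1.eventually_lt h2 hlt
  obtain ⟨ε, hε, hball⟩ := Metric.mem_nhdsWithin_iff.1 hnear
  have hsmall : Tendsto (fun N => (n : ℝ) / ((φ N : ℝ) + 1)) atTop (𝓝 0) :=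
    (tendsto_const_div_atTop_nhds_zero_nat (n : ℝ)).comp
      ((tendsto_add_atTop_nat 1).comp hφ.tendsto_atTop) |>.congr fun N => by simp
  have hlimi := ((continuous_apply i).tendsto x).comp hlim
  have hev := ((hsmall.eventually_lt hlimi hxi).and
    (hsmall.eventually_lt_const (half_pos hε))).and
      (hlim.eventually (Metric.ball_mem_nhds x (half_pos hε)))
  obtain ⟨N, ⟨hN1, hN2⟩, hN3⟩ := hev.exists
  have hden : (0 : ℝ) < (φ N : ℝ) + 1 := by positivity
  rcases htc (φ N) i with hti | ⟨u, hu, hci, hclose⟩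
  · refine absurd hN1 (not_lt.2 ?_)
    simp only [Function.comp, scale]
    gcongr
  · have hdist : dist (scale (φ N) u) (scale (φ N) (t (φ N))) ≤ n / ((φ N : ℝ) + 1) := by
      refine (dist_pi_le_iff (by positivity)).2 fun j => ?_
      obtain ⟨h1, h2⟩ := hclose j
      have h1' : (t (φ N) j : ℝ) ≤ u j + n := by exact_mod_cast h1.le
      have h2' : (u j : ℝ) ≤ t (φ N) j + n := by exact_mod_cast h2.le
      simp only [scale]
      rw [Real.dist_eq, ← sub_div, abs_div, abs_of_pos hden]
      gcongr
      rw [abs_le]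
      constructor <;> linarith
    have hmem : scale (φ N) u ∈ Metric.ball x ε := by
      have h3 : dist (scale (φ N) (t (φ N))) x < ε / 2 := hN3
      have := dist_triangle (scale (φ N) u) (scale (φ N) (t (φ N))) x
      rw [Metric.mem_ball]
      linarith
    have h4 : h (scale (φ N) u) i < scale (φ N) u i * ∑ j, h (scale (φ N) u) j :=
      hball ⟨hmem, hscale _ _ hu⟩
    have h5 := hc (φ N) u hu
    rw [hci] at h5
    exact absurd h5 (not_le.2 h4)

/-- A tangential continuous vector field on the simplex has a point where
all its coordinates are nonnegative. -/
theorem exists_forall_nonneg_of_sum_mul_eq_zero {ι : Type*} [Fintype ι] [Nonempty ι]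
    {ψ : (ι → ℝ) → ι → ℝ} (hcont : ContinuousOn ψ (stdSimplex ℝ ι))
    (hψ : ∀ x ∈ stdSimplex ℝ ι, ∑ i, x i * ψ x i = 0) :
    ∃ x ∈ stdSimplex ℝ ι, ∀ i, 0 ≤ ψ x i := by
  obtain ⟨x, hx, h⟩ := exists_mul_sum_le_of_continuousOn_stdSimplex
    (h := fun x i => max 0 (-ψ x i))
    (continuousOn_pi.2 fun i => continuousOn_const.sup (continuousOn_pi.1 hcont i).neg)
    fun x _ i => le_max_left _ _
  refine ⟨x, hx, ?_⟩
  set H := ∑ j, max 0 (-ψ x j) with hH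
  have hH0 : 0 ≤ H := Finset.sum_nonneg fun j _ => le_max_left _ _
  rcases hH0.eq_or_lt with hH0 | hH0
  · intro i
    have := (Finset.sum_eq_zero_iff_of_nonneg fun j _ => le_max_left _ _).1 hH0.symm i
      (Finset.mem_univ i)
    have := (le_max_right 0 (-ψ x i)).trans_eq this
    linarith
  · exfalso
    have hneg : ∀ i, 0 < x i → ψ x i < 0 := by
      intro i hi
      rcases lt_max_iff.1 ((mul_pos hi hH0).trans_le (h i)) with h0 | h0
      · exact absurd h0 (lt_irrefl _)
      · linarith
    obtain ⟨i, hi⟩ : ∃ i, 0 < x i := by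
      by_contra! hle
      have := Finset.sum_nonpos fun i (_ : i ∈ Finset.univ) => hle i
      rw [hx.2] at this
      linarith
    have : ∑ i, x i * ψ x i < ∑ _i : ι, (0 : ℝ) := by
      refine Finset.sum_lt_sum (fun j _ => ?_) ⟨i, Finset.mem_univ i,
        mul_neg_of_pos_of_neg hi (hneg i hi)⟩
      rcases (hx.1 j).eq_or_lt with h0 | h0
      · rw [← h0, zero_mul]
      · exact (mul_neg_of_pos_of_neg h0 (hneg j h0)).le
    rw [hψ x hx] at this
    simp at this

section Deviation

variable {ι : Type*} [Fintype ι] [DecidableEq ι] {α : ι → Type*} [∀ i, MeasurableSpace (α i)]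

/-- Resampling one coordinate of a product probability measure leaves it unchanged. -/
theorem measurePreserving_update_prod (μ : ∀ i, Measure (α i)) [∀ i, IsProbabilityMeasure (μ i)]
    (i : ι) :
    MeasurePreserving (fun p : (∀ j, α j) × α i => Function.update p.1 i p.2)
      ((Measure.pi μ).prod (μ i)) (Measure.pi μ) := by
  have hmeas : Measurable fun p : (∀ j, α j) × α i => Function.update p.1 i p.2 := by
    refine measurable_pi_iff.2 fun j => ?_
    rcases eq_or_ne j i with rfl | hj
    · simpa using measurable_snd
    · simp only [Function.update_of_ne hj]
      exact (measurable_pi_apply j).comp measurable_fst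
  refine ⟨hmeas, (Measure.pi_eq fun s hs => ?_).symm⟩
  have hpre : (fun p : (∀ j, α j) × α i => Function.update p.1 i p.2) ⁻¹' Set.pi Set.univ s =
      (Set.pi Set.univ (Function.update s i Set.univ)) ×ˢ s i := by
    ext p
    simp only [Set.mem_preimage, Set.mem_univ_pi, Set.mem_prod]
    refine ⟨fun h => ⟨fun j => ?_, by simpa using h i⟩, fun h j => ?_⟩
    · rcases eq_or_ne j i with rfl | hj
      · simp
      · simpa [hj] using h j
    · rcases eq_or_ne j i with rfl | hj
      · simpa using h.2
      · simpa [hj] using h.1 j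
  rw [Measure.map_apply hmeas (MeasurableSet.univ_pi hs), hpre, Measure.prod_prod,
    Measure.pi_pi, ← Finset.mul_prod_erase _ _ (Finset.mem_univ i),
    ← Finset.mul_prod_erase _ (fun j => μ j (s j)) (Finset.mem_univ i)]
  simp only [Function.update_self, measure_univ, one_mul]
  rw [mul_comm]
  congr 1
  exact Finset.prod_congr rfl fun j hj => by simp [(Finset.mem_erase.1 hj).1]

variable [∀ i, TopologicalSpace (α i)] [∀ i, SecondCountableTopology (α i)]
  [∀ i, BorelSpace (α i)]

theorem integrable_integral_update (μ : ∀ i, Measure (α i)) [∀ i, IsProbabilityMeasure (μ i)]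
    (i : ι) (ν : Measure (α i)) [IsProbabilityMeasure ν]
    (f : BoundedContinuousFunction (∀ i, α i) ℝ) :
    Integrable (fun a => ∫ z, f (Function.update z i a) ∂Measure.pi μ) ν :=
  Integrable.integral_prod_right
    (f := fun p : (∀ j, α j) × α i => f (Function.update p.1 i p.2))
    ((f.compContinuous ⟨fun p : (∀ j, α j) × α i => Function.update p.1 i p.2,
      continuous_fst.update i continuous_snd⟩).integrable ((Measure.pi μ).prod ν))

theorem integral_integral_update (μ : ∀ i, Measure (α i)) [∀ i, IsProbabilityMeasure (μ i)]
    (i : ι) (f : BoundedContinuousFunction (∀ i, α i) ℝ) :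
    ∫ a, ∫ z, f (Function.update z i a) ∂Measure.pi μ ∂μ i = ∫ z, f z ∂Measure.pi μ := by
  have hmp := measurePreserving_update_prod μ i
  have hf : AEStronglyMeasurable f (Measure.pi μ) := f.continuous.aestronglyMeasurable
  rw [← integral_prod_symm (fun p : (∀ j, α j) × α i => f (Function.update p.1 i p.2))
    ((hmp.integrable_comp hf).2 (f.integrable _)), ← hmp.map_eq,
    integral_map hmp.measurable.aemeasurable (by rwa [hmp.map_eq]), hmp.map_eq]

/-- The loss of player `i` when unilaterally deviating from the mixed profile `ν` to the pure
strategy `a`. -/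
noncomputable def deviationLoss (φ : ι → BoundedContinuousFunction (∀ i, α i) ℝ)
    (ν : ∀ i, ProbabilityMeasure (α i)) (i : ι) (a : α i) : ℝ :=
  ∫ z, φ i (Function.update z i a) ∂Measure.pi (fun j => (ν j : Measure (α j))) -
    ∫ z, φ i z ∂Measure.pi (fun j => (ν j : Measure (α j)))

theorem integrable_deviationLoss (φ : ι → BoundedContinuousFunction (∀ i, α i) ℝ)
    (ν : ∀ i, ProbabilityMeasure (α i)) (i : ι) :
    Integrable (deviationLoss φ ν i) (ν i : Measure (α i)) :=
  (integrable_integral_update (fun j => (ν j : Measure (α j))) i (ν i) (φ i)).sub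
    (integrable_const _)

theorem integral_deviationLoss (φ : ι → BoundedContinuousFunction (∀ i, α i) ℝ)
    (ν : ∀ i, ProbabilityMeasure (α i)) (i : ι) :
    ∫ a, deviationLoss φ ν i a ∂(ν i : Measure (α i)) = 0 := by
  unfold deviationLoss
  rw [integral_sub
    (integrable_integral_update (fun j => (ν j : Measure (α j))) i (ν i) (φ i))
    (integrable_const _), integral_integral_update (fun j => (ν j : Measure (α j)))]
  simp

theorem continuous_deviationLoss [∀ i, TopologicalSpace.PseudoMetrizableSpace (α i)]
    (φ : ι → BoundedContinuousFunction (∀ i, α i) ℝ) (i : ι) (a : α i) :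
    Continuous fun ν : ∀ i, ProbabilityMeasure (α i) => deviationLoss φ ν i a := by
  have h (f : BoundedContinuousFunction (∀ i, α i) ℝ) :
      Continuous fun ν : ∀ i, ProbabilityMeasure (α i) =>
        ∫ z, f z ∂Measure.pi (fun j => (ν j : Measure (α j))) :=
    (ProbabilityMeasure.continuous_integral_boundedContinuousFunction f).comp
      ProbabilityMeasure.continuous_pi
  exact (h ((φ i).compContinuous ⟨fun z => Function.update z i a,
    continuous_id.update i continuous_const⟩)).sub (h (φ i))

/-- The mixture of finitely many Dirac masses with weights in the simplex. -/
noncomputable def diracMixture {D E : Type*} [Fintype D] [MeasurableSpace E] (x : D → E)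
    (w : stdSimplex ℝ D) : ProbabilityMeasure E :=
  ⟨∑ d, ENNReal.ofReal (w.1 d) • Measure.dirac (x d), ⟨by
    simp only [Measure.coe_finsetSum, Finset.sum_apply, Measure.smul_apply, measure_univ,
      smul_eq_mul, mul_one]
    rw [← ENNReal.ofReal_sum_of_nonneg fun d _ => w.2.1 d, w.2.2, ENNReal.ofReal_one]⟩⟩

theorem integral_diracMixture {D E : Type*} [Fintype D] [MeasurableSpace E]
    [MeasurableSingletonClass E] (x : D → E) (w : stdSimplex ℝ D) (f : E → ℝ) :
    ∫ e, f e ∂(diracMixture x w : Measure E) = ∑ d, w.1 d * f (x d) := by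
  have : (diracMixture x w : Measure E) = ∑ d, ENNReal.ofReal (w.1 d) • Measure.dirac (x d) := rfl
  rw [this, integral_finsetSum_measure fun d _ =>
    (integrable_dirac (by simp)).smul_measure ENNReal.ofReal_ne_top]
  refine Finset.sum_congr rfl fun d _ => ?_
  rw [integral_smul_measure, integral_dirac, ENNReal.toReal_ofReal (w.2.1 d), smul_eq_mul]

theorem continuous_diracMixture {D E : Type*} [Fintype D] [MeasurableSpace E]
    [TopologicalSpace E] [OpensMeasurableSpace E] [MeasurableSingletonClass E] (x : D → E) :
    Continuous (diracMixture x) := by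
  refine ProbabilityMeasure.continuous_iff_forall_continuous_integral.2 fun f => ?_
  simp_rw [integral_diracMixture]
  exact continuous_finsetSum _ fun d _ =>
    ((continuous_apply d).comp continuous_subtype_val).mul continuous_const

/-- **Glicksberg's theorem**: a game with finitely many players, compact metrizable strategy
spaces and continuous costs has a mixed equilibrium. -/
theorem exists_forall_deviationLoss_nonneg [∀ i, TopologicalSpace.MetrizableSpace (α i)]
    [∀ i, CompactSpace (α i)] [∀ i, Nonempty (α i)]
    (φ : ι → BoundedContinuousFunction (∀ i, α i) ℝ) :
    ∃ ν : ∀ i, ProbabilityMeasure (α i), ∀ i a, 0 ≤ deviationLoss φ ν i a := by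
  classical
  let A : (∀ i, α i) → Set (∀ i, ProbabilityMeasure (α i)) :=
    fun x => {ν | 0 ≤ ∑ i, deviationLoss φ ν i (x i)}
  have hA : ∀ x, IsClosed (A x) := fun x => isClosed_le continuous_const
    (continuous_finsetSum _ fun i _ => continuous_deviationLoss φ i (x i))
  have hfin : ∀ D : Finset (∀ i, α i), (Set.univ ∩ ⋂ x ∈ D, A x).Nonempty := by
    intro D
    rw [Set.univ_inter]
    rcases D.eq_empty_or_nonempty with rfl | hD
    · exact ⟨fun i => diracProba (Classical.arbitrary (α i)), by simp⟩
    have : Nonempty D := hD.to_subtype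
    let mix : stdSimplex ℝ D → ∀ i, ProbabilityMeasure (α i) :=
      fun w i => diracMixture (fun d : D => d.1 i) w
    have hmix : Continuous mix := _root_.continuous_pi fun i => continuous_diracMixture _
    let ψ : (D → ℝ) → D → ℝ := fun w d =>
      if hw : w ∈ stdSimplex ℝ D then ∑ i, deviationLoss φ (mix ⟨w, hw⟩) i (d.1 i) else 0
    obtain ⟨w, hw, hpos⟩ := exists_forall_nonneg_of_sum_mul_eq_zero (ψ := ψ) (by
      rw [continuousOn_iff_continuous_domRestrict]
      refine _root_.continuous_pi fun d => ?_
      have : Continuous fun w : stdSimplex ℝ D => ∑ i, deviationLoss φ (mix w) i (d.1 i) :=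
        continuous_finsetSum _ fun i _ => (continuous_deviationLoss φ i (d.1 i)).comp hmix
      refine this.congr fun w => ?_
      simp [ψ]) (by
      intro w hw
      simp only [ψ, hw, dif_pos, Finset.mul_sum]
      rw [Finset.sum_comm]
      refine Finset.sum_eq_zero fun i _ => ?_
      rw [← integral_deviationLoss φ (mix ⟨w, hw⟩) i]
      exact (integral_diracMixture (fun d : D => d.1 i) ⟨w, hw⟩ _).symm)
    refine ⟨mix ⟨w, hw⟩, Set.mem_iInter₂.2 fun x hx => ?_⟩
    have := hpos ⟨x, hx⟩
    simp only [ψ, hw, dif_pos] at this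
    exact this
  obtain ⟨ν, -, hν⟩ := isCompact_univ.inter_iInter_nonempty A hA hfin
  refine ⟨ν, fun i a => ?_⟩
  have hle : ∀ j, ∃ x, deviationLoss φ ν j x ≤ 0 := fun j => by
    rw [← integral_deviationLoss φ ν j]
    exact exists_le_integral (integrable_deviationLoss φ ν j)
  choose x hx using hle
  have hsum : 0 ≤ ∑ j, deviationLoss φ ν j (Function.update x i a j) :=
    Set.mem_iInter.1 hν (Function.update x i a)
  rw [← Finset.add_sum_erase _ _ (Finset.mem_univ i), Function.update_self] at hsum
  have : ∑ j ∈ Finset.univ.erase i, deviationLoss φ ν j (Function.update x i a j) ≤ 0 :=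
    Finset.sum_nonpos fun j hj => by
      rw [Function.update_of_ne (Finset.mem_erase.1 hj).1]
      exact hx j
  linarith

end Deviation

section ValueFunction

/-- **Tietze extension** for a real function that is continuous on a compact closed set. -/
theorem exists_boundedContinuousFunction_eqOn {Z : Type*} [TopologicalSpace Z] [NormalSpace Z]
    {K : Set Z} (hK : IsCompact K) (hKc : IsClosed K) {f : Z → ℝ} (hf : ContinuousOn f K) :
    ∃ F : BoundedContinuousFunction Z ℝ, Set.EqOn f F K := by
  have : CompactSpace K := isCompact_iff_compactSpace.1 hK
  obtain ⟨F, -, hF⟩ := BoundedContinuousFunction.exists_extension_norm_eq_of_isClosedEmbedding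
    (BoundedContinuousFunction.mkOfCompact
      ⟨fun x : K => f x, continuousOn_iff_continuous_domRestrict.1 hf⟩)
    hKc.isClosedEmbedding_subtypeVal
  exact ⟨F, fun x hx => (congrFun hF ⟨x, hx⟩).symm⟩

/-- Integrating a continuous cost against a weakly continuous belief gives a continuous value
function. -/
theorem continuousOn_setIntegral_of_tendsto_integral {X Y : Type*}
    [TopologicalSpace X] [TopologicalSpace.MetrizableSpace X] [SecondCountableTopology X]
    [MeasurableSpace X] [BorelSpace X]
    [TopologicalSpace Y] [TopologicalSpace.MetrizableSpace Y] [SecondCountableTopology Y]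
    [MeasurableSpace Y] [BorelSpace Y]
    {K : Set X} {L : Set Y} (hK : IsCompact K) (hL : IsCompact L) {θ : X × Y → ℝ}
    (hθ : ContinuousOn θ (K ×ˢ L)) {β : X → Measure Y}
    (hβ : ∀ x ∈ K, IsProbabilityMeasure (β x)) (hβL : ∀ x ∈ K, β x L = 1)
    (hw : ∀ (u : ℕ → X) (x : X), (∀ n, u n ∈ K) → x ∈ K → Tendsto u atTop (𝓝 x) →
      ∀ f : Y → ℝ, Continuous f → (∃ C, ∀ y, |f y| ≤ C) →
        Tendsto (fun n => ∫ y, f y ∂β (u n)) atTop (𝓝 (∫ y, f y ∂β x))) :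
    ContinuousOn (fun x => ∫ y in L, θ (x, y) ∂β x) K := by
  let := TopologicalSpace.metrizableSpaceMetric X
  let := TopologicalSpace.metrizableSpaceMetric Y
  obtain ⟨Θ, hΘ⟩ :=
    exists_boundedContinuousFunction_eqOn (hK.prod hL) (hK.prod hL).isClosed hθ
  let B : K → ProbabilityMeasure Y := fun x => ⟨β x, hβ x x.2⟩
  have hB : Continuous B := by
    refine continuous_iff_seqContinuous.2 fun u x hu => ?_
    refine ProbabilityMeasure.tendsto_iff_forall_integral_tendsto.2 fun f => ?_
    exact hw (fun n => (u n : X)) x (fun n => (u n).2) x.2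
      ((continuous_subtype_val.tendsto x).comp hu) f f.continuous
      ⟨‖f‖, fun y => f.norm_coe_le_norm y⟩
  rw [continuousOn_iff_continuous_domRestrict]
  have hcont : Continuous fun x : K =>
      ∫ p, Θ p ∂((diracProba (x : X)).prod (B x) : Measure (X × Y)) :=
    (ProbabilityMeasure.continuous_integral_boundedContinuousFunction Θ).comp
      (ProbabilityMeasure.continuous_prod.comp
        ((continuous_diracProba.comp continuous_subtype_val).prodMk hB))
  refine hcont.congr fun x => ?_
  have := hβ x x.2
  have hae : ∀ᵐ y ∂β x, y ∈ L := (mem_ae_iff_prob_eq_one hL.measurableSet).2 (hβL x x.2)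
  have hBx : ((diracProba (x : X)).prod (B x) : Measure (X × Y)) =
      (Measure.dirac (x : X)).prod (β x) := rfl
  rw [hBx, Measure.dirac_prod, integral_map (by fun_prop)
    Θ.continuous.aestronglyMeasurable]
  change _ = ∫ y in L, θ (x, y) ∂β x
  rw [Measure.restrict_eq_self_of_ae_mem hae]
  refine integral_congr_ae ?_
  filter_upwards [hae] with y hy
  exact (hΘ ⟨x.2, hy⟩).symm

end ValueFunction

section Transfer

variable {ι : Type*} [Fintype ι] {α : ι → Type*} [∀ i, MeasurableSpace (α i)]

theorem ae_mem_pi {μ : ∀ i, Measure (α i)} [∀ i, IsProbabilityMeasure (μ i)]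
    {K : ∀ i, Set (α i)} (hK : ∀ i, MeasurableSet (K i)) (hμ : ∀ i, μ i (K i) = 1) :
    ∀ᵐ z ∂Measure.pi μ, ∀ i, z i ∈ K i := by
  have : Set.pi Set.univ K ∈ ae (Measure.pi μ) :=
    (mem_ae_iff_prob_eq_one (MeasurableSet.univ_pi hK)).2 (by simp [Measure.pi_pi, hμ])
  filter_upwards [this] with z hz i using hz i (Set.mem_univ i)

theorem integral_pi_subtype_ne [DecidableEq ι] (μ : ∀ i, Measure (α i))
    [∀ i, IsProbabilityMeasure (μ i)] (i : ι) {g : (∀ j : {j // j ≠ i}, α j) → ℝ}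
    (hg : AEStronglyMeasurable g (Measure.pi fun j : {j // j ≠ i} => μ j)) :
    ∫ z, g z ∂(Measure.pi fun j : {j // j ≠ i} => μ j) =
      ∫ z, g (fun j => z j) ∂Measure.pi μ := by
  have hmp : MeasurePreserving (fun (z : ∀ j, α j) (j : {j // j ≠ i}) => z j) (Measure.pi μ)
      (Measure.pi fun j : {j // j ≠ i} => μ j) :=
    measurePreserving_fst.comp (measurePreserving_piEquivPiSubtypeProd μ fun j => j ≠ i)
  rw [← hmp.map_eq, integral_map hmp.measurable.aemeasurable (by rwa [hmp.map_eq])]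

variable [∀ i, TopologicalSpace (α i)] [∀ i, SecondCountableTopology (α i)]
  [∀ i, BorelSpace (α i)] [∀ i, TopologicalSpace.MetrizableSpace (α i)]

/-- Glicksberg's theorem for games whose strategy sets are compact subsets. -/
theorem exists_forall_integral_le_integral_update [DecidableEq ι] {K : ∀ i, Set (α i)}
    (hKne : ∀ i, (K i).Nonempty) (hK : ∀ i, IsCompact (K i))
    (φ : ι → BoundedContinuousFunction (∀ i, α i) ℝ) :
    ∃ ν : ∀ i, Measure (α i), (∀ i, IsProbabilityMeasure (ν i)) ∧ (∀ i, ν i (K i) = 1) ∧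
      ∀ i, ∀ a ∈ K i,
        ∫ z, φ i z ∂Measure.pi ν ≤ ∫ z, φ i (Function.update z i a) ∂Measure.pi ν := by
  have : ∀ i, CompactSpace (K i) := fun i => isCompact_iff_compactSpace.1 (hK i)
  have : ∀ i, Nonempty (K i) := fun i => (hKne i).to_subtype
  let emb : (∀ i, K i) → ∀ i, α i := fun z i => z i
  have hemb : Continuous emb := by fun_prop
  obtain ⟨ν, hν⟩ := exists_forall_deviationLoss_nonneg (α := fun i => K i)
    fun i => (φ i).compContinuous ⟨emb, hemb⟩
  have hprob : ∀ i, IsProbabilityMeasure ((ν i : Measure (K i)).map Subtype.val) :=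
    fun i => Measure.isProbabilityMeasure_map measurable_subtype_coe.aemeasurable
  have hpi : Measure.pi (fun i => (ν i : Measure (K i)).map Subtype.val) =
      (Measure.pi fun i => (ν i : Measure (K i))).map emb :=
    (Measure.pi_map_pi fun i => measurable_subtype_coe.aemeasurable).symm
  have hint (f : (∀ i, α i) → ℝ) (hf : Continuous f) :
      ∫ z, f z ∂Measure.pi (fun i => (ν i : Measure (K i)).map Subtype.val) =
        ∫ z, f (emb z) ∂Measure.pi fun i => (ν i : Measure (K i)) := by
    rw [hpi, integral_map hemb.measurable.aemeasurable hf.aestronglyMeasurable]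
  refine ⟨fun i => (ν i : Measure (K i)).map Subtype.val, hprob, fun i => ?_, fun i a ha => ?_⟩
  · rw [Measure.map_apply measurable_subtype_coe (hK i).measurableSet]
    simp
  · rw [hint _ (φ i).continuous, hint (fun z => φ i (Function.update z i a))
      ((φ i).continuous.comp (continuous_id.update i continuous_const))]
    have h := sub_nonneg.1 (hν i ⟨a, ha⟩)
    refine h.trans_eq (integral_congr_ae (.of_forall fun z => ?_))
    change φ i (emb (Function.update z i ⟨a, ha⟩)) = φ i (Function.update (emb z) i a)
    congr 1
    funext j
    rcases eq_or_ne j i with rfl | hj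
    · simp [emb]
    · simp [emb, hj]

end Transfer

theorem combineProfile_self {ι : Type} [DecidableEq ι] (dm : ι → ℕ) (i : ι)
    (a : EuclideanSpace ℝ (Fin (dm i)))
    (xm : ∀ j : {j : ι // j ≠ i}, EuclideanSpace ℝ (Fin (dm j.1))) :
    combineProfile dm i a xm i = a := by
  simp [combineProfile]

theorem combineProfile_of_ne {ι : Type} [DecidableEq ι] (dm : ι → ℕ) {i j : ι} (hj : j ≠ i)
    (a : EuclideanSpace ℝ (Fin (dm i)))
    (xm : ∀ j : {j : ι // j ≠ i}, EuclideanSpace ℝ (Fin (dm j.1))) :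
    combineProfile dm i a xm j = xm ⟨j, hj⟩ := by
  simp [combineProfile, hj]

theorem combineProfile_restrict {ι : Type} [DecidableEq ι] (dm : ι → ℕ) (i : ι)
    (a : EuclideanSpace ℝ (Fin (dm i))) (z : ∀ j, EuclideanSpace ℝ (Fin (dm j))) :
    combineProfile dm i a (fun j => z j) = Function.update z i a := by
  funext j
  rcases eq_or_ne j i with rfl | hj
  · simp [combineProfile_self]
  · simp [combineProfile_of_ne dm hj, hj]

theorem continuous_combineProfile {ι : Type} [DecidableEq ι] (dm : ι → ℕ) (i : ι)
    (a : EuclideanSpace ℝ (Fin (dm i))) : Continuous (combineProfile dm i a) := by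
  refine _root_.continuous_pi fun j => ?_
  rcases eq_or_ne j i with rfl | hj
  · simpa only [combineProfile_self] using continuous_const
  · simpa only [combineProfile_of_ne dm hj] using continuous_apply _

/-- Existence of mixed equilibria for bilevel games in the Bayesian
approach with finitely many leaders: each value function
`φ_i(x) = ∫_Y θ_i(x,y) dβ^i_x(y)` is continuous on `X = ∏ X_i`, and there is a family
of probability measures `(ν_i)` (each supported on `X_i`) such that no player can
improve by a unilateral deviation to another mixed strategy. -/
theorem stmt_1 {ι : Type} [Fintype ι] [DecidableEq ι] [Nonempty ι] (dm : ι → ℕ) {p : ℕ}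
    (Xs : ∀ i : ι, Set (EuclideanSpace ℝ (Fin (dm i))))
    (hXne : ∀ i, (Xs i).Nonempty) (hXcomp : ∀ i, IsCompact (Xs i))
    (Y : Set (EuclideanSpace ℝ (Fin p)))
    (hYne : Y.Nonempty) (hYcomp : IsCompact Y)
    -- reaction map with nonempty Borel-measurable values contained in `Y`
    (S : (∀ j, EuclideanSpace ℝ (Fin (dm j))) → Set (EuclideanSpace ℝ (Fin p)))
    (hSne : ∀ x ∈ Set.pi Set.univ Xs, (S x).Nonempty)
    (hSmeas : ∀ x ∈ Set.pi Set.univ Xs, MeasurableSet (S x))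
    (hSY : ∀ x ∈ Set.pi Set.univ Xs, S x ⊆ Y)
    -- cost functions, continuous on `X × Y`
    (θ : ι → ((∀ j, EuclideanSpace ℝ (Fin (dm j))) × EuclideanSpace ℝ (Fin p)) → ℝ)
    (hθ : ∀ i, ContinuousOn (θ i) ((Set.pi Set.univ Xs) ×ˢ Y))
    -- belief system over `S`
    (β : ι → (∀ j, EuclideanSpace ℝ (Fin (dm j))) → Measure (EuclideanSpace ℝ (Fin p)))
    (hβprob : ∀ i, ∀ x ∈ Set.pi Set.univ Xs, IsProbabilityMeasure (β i x))
    (hβS : ∀ i, ∀ x ∈ Set.pi Set.univ Xs, β i x (S x) = 1)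
    -- weak continuity of each belief
    (hβw : ∀ i, ∀ (xseq : ℕ → ∀ j, EuclideanSpace ℝ (Fin (dm j)))
      (xb : ∀ j, EuclideanSpace ℝ (Fin (dm j))),
      (∀ n, xseq n ∈ Set.pi Set.univ Xs) → xb ∈ Set.pi Set.univ Xs →
      Tendsto xseq atTop (𝓝 xb) →
      ∀ f : EuclideanSpace ℝ (Fin p) → ℝ, Continuous f → (∃ C, ∀ y, |f y| ≤ C) →
        Tendsto (fun n => ∫ y, f y ∂(β i (xseq n))) atTop (𝓝 (∫ y, f y ∂(β i xb)))) :
    -- each value function is continuous on `X`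
    (∀ i, ContinuousOn (fun x => ∫ y in Y, θ i (x, y) ∂(β i x)) (Set.pi Set.univ Xs)) ∧
    -- and a mixed equilibrium exists
    ∃ ν : ∀ i, Measure (EuclideanSpace ℝ (Fin (dm i))),
      (∀ i, IsProbabilityMeasure (ν i)) ∧ (∀ i, ν i (Xs i) = 1) ∧
      ∀ i : ι, ∀ ν' : Measure (EuclideanSpace ℝ (Fin (dm i))),
        IsProbabilityMeasure ν' → ν' (Xs i) = 1 →
        (∫ xi, ∫ xm, (∫ y in Y, θ i (combineProfile dm i xi xm, y)
              ∂(β i (combineProfile dm i xi xm)))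
            ∂(Measure.pi fun j : {j : ι // j ≠ i} => ν j.1) ∂(ν i)) ≤
        (∫ xi, ∫ xm, (∫ y in Y, θ i (combineProfile dm i xi xm, y)
              ∂(β i (combineProfile dm i xi xm)))
            ∂(Measure.pi fun j : {j : ι // j ≠ i} => ν j.1) ∂ν') := by
  have hval : ∀ i, ContinuousOn (fun x => ∫ y in Y, θ i (x, y) ∂(β i x)) (Set.pi Set.univ Xs) :=
    fun i => continuousOn_setIntegral_of_tendsto_integral (isCompact_univ_pi hXcomp) hYcomp (hθ i)
      (hβprob i) (fun x hx => by
        have := hβprob i x hx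
        exact le_antisymm prob_le_one ((hβS i x hx).symm.le.trans (measure_mono (hSY x hx))))
      (hβw i)
  refine ⟨hval, ?_⟩
  have hXpi := isCompact_univ_pi hXcomp
  choose φ hφ using fun i => exists_boundedContinuousFunction_eqOn hXpi hXpi.isClosed (hval i)
  obtain ⟨ν, hνprob, hνX, hν⟩ := exists_forall_integral_le_integral_update hXne hXcomp φ
  have hXmeas : ∀ i, MeasurableSet (Xs i) := fun i => (hXcomp i).measurableSet
  have hinner : ∀ i, ∀ a ∈ Xs i,
      (∫ xm, (∫ y in Y, θ i (combineProfile dm i a xm, y) ∂(β i (combineProfile dm i a xm)))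
        ∂(Measure.pi fun j : {j : ι // j ≠ i} => ν j.1)) =
        ∫ z, φ i (Function.update z i a) ∂Measure.pi ν := by
    intro i a ha
    have hae := ae_mem_pi (μ := fun j : {j : ι // j ≠ i} => ν j.1) (fun j => hXmeas j.1)
      fun j => hνX j.1
    trans ∫ xm, φ i (combineProfile dm i a xm) ∂(Measure.pi fun j : {j : ι // j ≠ i} => ν j.1)
    · refine integral_congr_ae ?_
      filter_upwards [hae] with xm hxm
      refine hφ i fun j _ => ?_
      rcases eq_or_ne j i with rfl | hj
      · rwa [combineProfile_self]
      · rw [combineProfile_of_ne dm hj]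
        exact hxm ⟨j, hj⟩
    · refine (integral_pi_subtype_ne ν i
        ((φ i).continuous.comp (continuous_combineProfile dm i a)).aestronglyMeasurable).trans ?_
      simp only [Function.comp_apply, combineProfile_restrict]
  have houter : ∀ i, ∀ μ : Measure (EuclideanSpace ℝ (Fin (dm i))), IsProbabilityMeasure μ →
      μ (Xs i) = 1 →
      (∫ xi, ∫ xm, (∫ y in Y, θ i (combineProfile dm i xi xm, y)
          ∂(β i (combineProfile dm i xi xm)))
        ∂(Measure.pi fun j : {j : ι // j ≠ i} => ν j.1) ∂μ) =
        ∫ xi, ∫ z, φ i (Function.update z i xi) ∂Measure.pi ν ∂μ := by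
    intro i μ hμ hμX
    refine integral_congr_ae ?_
    filter_upwards [(mem_ae_iff_prob_eq_one (hXmeas i)).2 hμX] with a ha using hinner i a ha
  refine ⟨ν, hνprob, hνX, fun i ν' hν' hν'X => ?_⟩
  rw [houter i (ν i) (hνprob i) (hνX i), houter i ν' hν' hν'X, integral_integral_update ν i (φ i)]
  calc ∫ z, φ i z ∂Measure.pi ν = ∫ _, ∫ z, φ i z ∂Measure.pi ν ∂ν' := by simp
    _ ≤ ∫ xi, ∫ z, φ i (Function.update z i xi) ∂Measure.pi ν ∂ν' := by
      refine integral_mono_ae (integrable_const _) (integrable_integral_update ν i ν' (φ i)) ?_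
      filter_upwards [(mem_ae_iff_prob_eq_one (hXmeas i)).2 hν'X] with a ha using hν i a ha
end

section
/- Consider the set-valued map S : [0,1] ⇉ [0,1]² defined by S(x) = {(y₁,y₂) ∈ [0,1]² : y₁ ≤ x·y₂}. Then S is continuous with nonempty convex compact values, the centroid of S(x) equals (x/3, 2/3) for every x ∈ (0,1], the centroid of S(0) equals (0, 1/2), and hence the centroid map x ↦ 𝔠(S(x)) is not continuous at x = 0. -/
open MeasureTheory Filter Topology Set Pointwise
open scoped ENNReal

/-- The affine dimension of a set: the dimension of its affine hull. -/
noncomputable def adim {p : ℕ} (A : Set (EuclideanSpace ℝ (Fin p))) : ℕ :=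
  Module.finrank ℝ (affineSpan ℝ A).direction

/-- The centroid of a set `K`, computed with respect to the `adim K`-dimensional
Hausdorff measure: `𝔠(K) = (1/λ_k(K)) ∫_K y dλ_k(y)` with `k = adim K`. -/
noncomputable def centroid {p : ℕ} (K : Set (EuclideanSpace ℝ (Fin p))) :
    EuclideanSpace ℝ (Fin p) :=
  (μH[(adim K : ℝ)] K).toReal⁻¹ •
    ∫ y in K, y ∂(μH[(adim K : ℝ)] : Measure (EuclideanSpace ℝ (Fin p)))

/-- Continuity of a set-valued map at a point (Hausdorff-distance style). -/
def SVContinuousAt {d p : ℕ} (X : Set (EuclideanSpace ℝ (Fin d)))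
    (S : EuclideanSpace ℝ (Fin d) → Set (EuclideanSpace ℝ (Fin p)))
    (xb : EuclideanSpace ℝ (Fin d)) : Prop :=
  ∀ ε > (0 : ℝ), ∃ δ > (0 : ℝ), ∀ x ∈ X, ‖x - xb‖ < δ →
    S x ⊆ S xb + Metric.closedBall 0 ε ∧ S xb ⊆ S x + Metric.closedBall 0 ε

/-- The set-valued map `S(x) = {(y₁,y₂) ∈ [0,1]² : y₁ ≤ x·y₂}` of Example 3.2,
viewed as a map from `ℝ` (identified with `ℝ¹`) into subsets of `ℝ²`. -/
def exS (x : ℝ) : Set (EuclideanSpace ℝ (Fin 2)) :=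
  {y | y 0 ∈ Set.Icc (0 : ℝ) 1 ∧ y 1 ∈ Set.Icc (0 : ℝ) 1 ∧ y 0 ≤ x * y 1}

noncomputable def exSvec (x : EuclideanSpace ℝ (Fin 1)) : Set (EuclideanSpace ℝ (Fin 2)) :=
  exS (x 0)

lemma isCompact_exS (x : ℝ) : IsCompact (exS x) := by
  have h : exS x = (EuclideanSpace.equiv (Fin 2) ℝ) ⁻¹'
      (Set.univ.pi (fun _ => Icc (0 : ℝ) 1) ∩ {y | y 0 ≤ x * y 1}) := by
    ext y
    simp [exS, and_assoc, -Set.pi_univ_Icc, Set.mem_pi, Fin.forall_fin_two]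
  rw [h]
  refine (EuclideanSpace.equiv (Fin 2) ℝ).toHomeomorph.isCompact_preimage.2 ?_
  exact (isCompact_univ_pi fun _ => isCompact_Icc).inter_right
    (isClosed_le (by fun_prop) (by fun_prop))

lemma convex_exS (x : ℝ) : Convex ℝ (exS x) := by
  rintro y ⟨hy0, hy1, hy⟩ z ⟨hz0, hz1, hz⟩ a b ha hb hab
  refine ⟨?_, ?_, ?_⟩
  · simpa using convex_Icc (0 : ℝ) 1 hy0 hz0 ha hb hab
  · simpa using convex_Icc (0 : ℝ) 1 hy1 hz1 ha hb hab
  · simp only [PiLp.add_apply, PiLp.smul_apply, smul_eq_mul]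
    nlinarith [mul_le_mul_of_nonneg_left hy ha, mul_le_mul_of_nonneg_left hz hb]

lemma nonempty_exS (x : ℝ) : (exS x).Nonempty := ⟨0, by simp [exS]⟩

lemma exS_subset_exS_add_closedBall {a b ε : ℝ} (hb : 0 ≤ b) (hab : |a - b| ≤ ε) :
    exS a ⊆ exS b + Metric.closedBall 0 ε := by
  rintro y ⟨hy0, hy1, hy⟩
  have hby : 0 ≤ b * y 1 := mul_nonneg hb hy1.1
  refine Set.mem_add.2 ⟨!₂[min (y 0) (b * y 1), y 1],
    ⟨⟨le_min hy0.1 hby, (min_le_left _ _).trans hy0.2⟩, hy1, min_le_right _ _⟩,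
    y - !₂[min (y 0) (b * y 1), y 1], ?_, add_sub_cancel _ _⟩
  have hε : 0 ≤ ε := (abs_nonneg _).trans hab
  have hnn : 0 ≤ y 0 - min (y 0) (b * y 1) := sub_nonneg.2 (min_le_left _ _)
  have hle : y 0 - min (y 0) (b * y 1) ≤ ε := by
    rw [sub_le_iff_le_add, ← min_add_add_left]
    refine le_min (by linarith) ?_
    nlinarith [(abs_le.1 hab).2, hy1.1, hy1.2]
  rw [mem_closedBall_zero_iff, EuclideanSpace.norm_eq]
  simpa [Fin.sum_univ_two, Real.sqrt_sq_eq_abs, abs_of_nonneg hnn] using hle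

lemma volume_preserving_euclidean_prod :
    MeasurePreserving (((MeasurableEquiv.toLp 2 (Fin 2 → ℝ)).symm).trans
      (MeasurableEquiv.finTwoArrow (α := ℝ))) :=
  (volume_preserving_finTwoArrow ℝ).comp
    (EuclideanSpace.volume_preserving_symm_measurableEquiv_toLp (Fin 2))

lemma setIntegral_exS {x : ℝ} (hx : x ∈ Icc (0 : ℝ) 1) {f : ℝ × ℝ → ℝ} (hf : Continuous f) :
    ∫ y in exS x, f (y 0, y 1) = ∫ t in (0 : ℝ)..1, ∫ s in (0 : ℝ)..(x * t), f (s, t) := by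
  set T : Set (ℝ × ℝ) := {p | p.1 ∈ Icc (0 : ℝ) 1 ∧ p.2 ∈ Icc (0 : ℝ) 1 ∧ p.1 ≤ x * p.2} with hT
  have hTsub : T ⊆ Icc 0 1 ×ˢ Icc 0 1 := fun p hp => ⟨hp.1, hp.2.1⟩
  have hTclosed : IsClosed T :=
    (isClosed_Icc.preimage continuous_fst).inter ((isClosed_Icc.preimage continuous_snd).inter
      (isClosed_le continuous_fst (by fun_prop)))
  have hTcompact : IsCompact T := (isCompact_Icc.prod isCompact_Icc).of_isClosed_subset hTclosed hTsub
  have hpre := volume_preserving_euclidean_prod.setIntegral_preimage_emb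
    (MeasurableEquiv.measurableEmbedding _) f T
  have hind (s t : ℝ) : T.indicator f (s, t) =
      (Icc (0 : ℝ) 1).indicator (fun t => (Icc 0 (x * t)).indicator (fun s => f (s, t)) s) t := by
    have : (s, t) ∈ T ↔ t ∈ Icc (0 : ℝ) 1 ∧ s ∈ Icc 0 (x * t) := by
      constructor
      · rintro ⟨h0, h1, h⟩
        exact ⟨h1, h0.1, h⟩
      · rintro ⟨h1, h0, h⟩
        exact ⟨⟨h0, h.trans (mul_le_one₀ hx.2 h1.1 h1.2)⟩, h1, h⟩
    by_cases h1 : t ∈ Icc (0 : ℝ) 1 <;> by_cases h2 : s ∈ Icc 0 (x * t) <;>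
      simp only [indicator, this, h1, h2, and_true, and_false, if_true, if_false]
  calc ∫ y in exS x, f (y 0, y 1) = ∫ p in T, f p := hpre
    _ = ∫ p, T.indicator f p := (integral_indicator hTclosed.measurableSet).symm
    _ = ∫ t, ∫ s, T.indicator f (s, t) := by
      rw [Measure.volume_eq_prod]
      refine integral_prod_symm _ ?_
      rw [integrable_indicator_iff hTclosed.measurableSet]
      exact hf.continuousOn.integrableOn_compact hTcompact
    _ = ∫ t, (Icc (0 : ℝ) 1).indicator (fun t => ∫ s in (0 : ℝ)..(x * t), f (s, t)) t := by
      congr 1 with t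
      simp only [hind]
      by_cases ht : t ∈ Icc (0 : ℝ) 1
      · simp only [indicator_of_mem ht]
        rw [integral_indicator measurableSet_Icc, integral_Icc_eq_integral_Ioc,
          intervalIntegral.integral_of_le (mul_nonneg hx.1 ht.1)]
      · simp [indicator_of_notMem ht]
    _ = _ := by
      rw [integral_indicator measurableSet_Icc, integral_Icc_eq_integral_Ioc,
        intervalIntegral.integral_of_le zero_le_one]

lemma adim_exS_of_pos {x : ℝ} (hx : x ∈ Ioc (0 : ℝ) 1) : adim (exS x) = 2 := by
  have hne : (interior (exS x)).Nonempty := by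
    have hcont (i : Fin 2) : Continuous fun y : EuclideanSpace ℝ (Fin 2) => y i := by fun_prop
    have hopen : IsOpen {y : EuclideanSpace ℝ (Fin 2) |
        (0 < y 0 ∧ y 0 < 1) ∧ (0 < y 1 ∧ y 1 < 1) ∧ y 0 < x * y 1} :=
      ((isOpen_lt continuous_const (hcont 0)).and (isOpen_lt (hcont 0) continuous_const)).and
        (((isOpen_lt continuous_const (hcont 1)).and (isOpen_lt (hcont 1) continuous_const)).and
          (isOpen_lt (hcont 0) ((hcont 1).const_mul x)))
    refine ⟨!₂[x / 4, 1 / 2], interior_maximal ?_ hopen ?_⟩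
    · rintro y ⟨h0, h1, h⟩
      exact ⟨⟨h0.1.le, h0.2.le⟩, ⟨h1.1.le, h1.2.le⟩, h.le⟩
    · have h0 := hx.1
      have h1 := hx.2
      refine ⟨⟨?_, ?_⟩, ⟨?_, ?_⟩, ?_⟩ <;> simp <;> linarith
  rw [adim, affineSpan_eq_top_of_nonempty_interior
    (hne.mono (interior_mono (subset_convexHull ℝ _))), AffineSubspace.direction_top, finrank_top]
  simp

lemma integrableOn_exS (x : ℝ) (μ : Measure (EuclideanSpace ℝ (Fin 2)))
    (hμ : μ (exS x) ≠ ∞) : IntegrableOn (fun y => y) (exS x) μ :=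
  continuousOn_id.integrableOn_of_subset_isCompact (isCompact_exS x)
    (isCompact_exS x).measurableSet subset_rfl hμ

lemma centroid_exS_of_pos {x : ℝ} (hx : x ∈ Ioc (0 : ℝ) 1) :
    centroid (exS x) = (EuclideanSpace.equiv (Fin 2) ℝ).symm ![x / 3, 2 / 3] := by
  have hx0 : x ≠ 0 := hx.1.ne'
  have hxI : x ∈ Icc (0 : ℝ) 1 := Ioc_subset_Icc_self hx
  have hH : (μH[(2 : ℕ)] : Measure (EuclideanSpace ℝ (Fin 2))).IsAddHaarMeasure := by
    simpa using isAddHaarMeasure_hausdorffMeasure (E := EuclideanSpace ℝ (Fin 2))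
  obtain ⟨c, hc0, hμ⟩ : ∃ c : NNReal, c ≠ 0 ∧
      (μH[(2 : ℕ)] : Measure (EuclideanSpace ℝ (Fin 2))) = c • volume :=
    ⟨_, (Measure.addHaarScalarFactor_pos_of_isAddHaarMeasure _ _).ne',
      Measure.isAddLeftInvariant_eq_smul _ _⟩
  have hvol : volume.real (exS x) = x / 2 := by
    have h := setIntegral_exS hxI (f := fun _ => 1) continuous_const
    simp only [setIntegral_const, intervalIntegral.integral_const, smul_eq_mul, mul_one,
      sub_zero] at h
    rw [h, intervalIntegral.integral_const_mul, integral_id]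
    ring
  have h0 : ∫ y in exS x, y 0 = x ^ 2 / 6 := by
    rw [setIntegral_exS hxI (f := fun p => p.1) continuous_fst]
    simp only [integral_id, mul_pow, intervalIntegral.integral_div, sub_zero, ne_eq,
      OfNat.ofNat_ne_zero, not_false_eq_true, zero_pow, intervalIntegral.integral_const_mul,
      integral_pow]
    norm_num
    ring
  have h1 : ∫ y in exS x, y 1 = x / 3 := by
    rw [setIntegral_exS hxI (f := fun p => p.2) continuous_snd]
    simp only [intervalIntegral.integral_const, smul_eq_mul, sub_zero, mul_assoc, ← sq,
      intervalIntegral.integral_const_mul, integral_pow]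
    norm_num
    ring
  have hint := integrableOn_exS x volume (isCompact_exS x).measure_lt_top.ne
  have heval (i : Fin 2) : (∫ y in exS x, y) i = ∫ y in exS x, y i :=
    eval_integral_piLp (fun j => (EuclideanSpace.proj (𝕜 := ℝ) j).integrable_comp hint) i
  have hc : (c : ℝ) ≠ 0 := by exact_mod_cast hc0
  have hreal : ((c • volume : Measure (EuclideanSpace ℝ (Fin 2))) (exS x)).toReal
      = c * (x / 2) := by
    rw [← hvol, Measure.smul_apply, ENNReal.smul_def, smul_eq_mul, ENNReal.toReal_mul,
      ENNReal.coe_toReal, Measure.real]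
  rw [centroid, adim_exS_of_pos hx, hμ, hreal, Measure.restrict_smul, integral_smul_nnreal_measure]
  ext i
  fin_cases i
  · change (c * (x / 2) : ℝ)⁻¹ * (c * (∫ y in exS x, y) 0) = x / 3
    rw [heval, h0]
    field_simp
    norm_num
  · change (c * (x / 2) : ℝ)⁻¹ * (c * (∫ y in exS x, y) 1) = 2 / 3
    rw [heval, h1]
    field_simp

lemma exS_zero : exS 0 = (fun t : ℝ => t • EuclideanSpace.single (1 : Fin 2) (1 : ℝ)) '' Icc 0 1 := by
  ext y
  constructor
  · rintro ⟨h0, h1, h⟩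
    refine ⟨y 1, h1, ?_⟩
    have : y 0 = 0 := le_antisymm (by simpa using h) h0.1
    ext i
    fin_cases i <;> simp [this]
  · rintro ⟨t, ht, rfl⟩
    simpa [exS] using ht

lemma isometry_smul_single :
    Isometry (fun t : ℝ => t • EuclideanSpace.single (1 : Fin 2) (1 : ℝ)) :=
  Isometry.of_dist_eq fun s t => by
    rw [dist_eq_norm, ← sub_smul, norm_smul, Real.dist_eq]
    simp

lemma adim_exS_zero : adim (exS 0) = 1 := by
  set e := EuclideanSpace.single (1 : Fin 2) (1 : ℝ) with he
  have hspan : vectorSpan ℝ (exS 0) = Submodule.span ℝ {e} := by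
    have hmem : (0 : EuclideanSpace ℝ (Fin 2)) ∈ exS 0 := by simp [exS]
    rw [vectorSpan_eq_span_vsub_set_right ℝ hmem]
    apply le_antisymm <;> rw [Submodule.span_le]
    · rintro _ ⟨y, hy, rfl⟩
      rw [exS_zero] at hy
      obtain ⟨t, -, rfl⟩ := hy
      simpa using Submodule.smul_mem _ t (Submodule.mem_span_singleton_self e)
    · rw [Set.singleton_subset_iff]
      exact Submodule.subset_span ⟨e, by simp [exS, he], by simp⟩
  rw [adim, direction_affineSpan, hspan]
  exact finrank_span_singleton (by simp [he])

lemma centroid_exS_zero :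
    centroid (exS 0) = (EuclideanSpace.equiv (Fin 2) ℝ).symm ![0, 1 / 2] := by
  have hm : MeasurableEmbedding (fun t : ℝ => t • EuclideanSpace.single (1 : Fin 2) (1 : ℝ)) :=
    isometry_smul_single.isClosedEmbedding.measurableEmbedding
  have hvol : μH[1] (exS 0) = 1 := by
    rw [exS_zero, isometry_smul_single.hausdorffMeasure_image (Or.inl zero_le_one),
      hausdorffMeasure_real]
    simp
  have hint : ∫ y in exS 0, y ∂(μH[1] : Measure (EuclideanSpace ℝ (Fin 2))) =
      (1 / 2 : ℝ) • EuclideanSpace.single (1 : Fin 2) (1 : ℝ) := by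
    have hsub : exS 0 ⊆ range (fun t : ℝ => t • EuclideanSpace.single (1 : Fin 2) (1 : ℝ)) :=
      exS_zero ▸ image_subset_range _ _
    rw [← inter_eq_left.2 hsub, ← Measure.restrict_restrict (isCompact_exS 0).measurableSet,
      ← isometry_smul_single.map_hausdorffMeasure (Or.inl zero_le_one), hm.setIntegral_map,
      exS_zero, isometry_smul_single.injective.preimage_image, hausdorffMeasure_real,
      integral_smul_const, integral_Icc_eq_integral_Ioc,
      ← intervalIntegral.integral_of_le zero_le_one, integral_id]
    norm_num
  rw [centroid, adim_exS_zero, Nat.cast_one, hvol, hint]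
  ext i
  fin_cases i <;> simp

lemma not_continuousWithinAt_centroid_exS :
    ¬ ContinuousWithinAt (fun x : ℝ => centroid (exS x)) (Icc 0 1) 0 := by
  intro h
  have h1 : Tendsto (fun x : ℝ => centroid (exS x) 1) (𝓝[>] 0) (𝓝 (centroid (exS 0) 1)) :=
    ((EuclideanSpace.proj (𝕜 := ℝ) (1 : Fin 2)).continuous.tendsto _).comp
      (h.mono_left (by
        rw [← nhdsWithin_Ioc_eq_nhdsGT zero_lt_one]
        exact nhdsWithin_mono _ Ioc_subset_Icc_self))
  have h2 : Tendsto (fun x : ℝ => centroid (exS x) 1) (𝓝[>] 0) (𝓝 (2 / 3)) := by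
    refine tendsto_const_nhds.congr' ?_
    filter_upwards [Ioc_mem_nhdsGT (zero_lt_one (α := ℝ))] with x hx
    simp [centroid_exS_of_pos hx]
  have h3 := tendsto_nhds_unique h1 h2
  rw [centroid_exS_zero] at h3
  norm_num at h3

/-- the map `S(x) = {(y₁,y₂) ∈ [0,1]² : y₁ ≤ x y₂}` on `[0,1]` is
continuous with nonempty convex compact values, its centroid is `(x/3, 2/3)` for
`x ∈ (0,1]` and `(0,1/2)` at `x = 0`, so the centroid map is not continuous at `0`
(along `[0,1]`). -/
theorem stmt_3 :
    -- `S` is continuous on `[0,1]` ...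
    (∀ xb ∈ Set.Icc (0 : ℝ) 1,
      SVContinuousAt ((fun t : ℝ => (EuclideanSpace.equiv (Fin 1) ℝ).symm ![t]) '' Set.Icc 0 1)
        exSvec ((EuclideanSpace.equiv (Fin 1) ℝ).symm ![xb])) ∧
    -- ... with nonempty convex compact values
    (∀ x ∈ Set.Icc (0 : ℝ) 1, (exS x).Nonempty ∧ Convex ℝ (exS x) ∧ IsCompact (exS x)) ∧
    -- centroid formulas
    (∀ x ∈ Set.Ioc (0 : ℝ) 1,
      centroid (exS x) = (EuclideanSpace.equiv (Fin 2) ℝ).symm ![x / 3, 2 / 3]) ∧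
    (centroid (exS 0) = (EuclideanSpace.equiv (Fin 2) ℝ).symm ![0, 1 / 2]) ∧
    -- hence the centroid map is not continuous at `x = 0`
    ¬ ContinuousWithinAt (fun x : ℝ => centroid (exS x)) (Set.Icc 0 1) 0 := by
  refine ⟨?_, fun x _ => ⟨nonempty_exS x, convex_exS x, isCompact_exS x⟩,
    fun x hx => centroid_exS_of_pos hx, centroid_exS_zero, not_continuousWithinAt_centroid_exS⟩
  rintro xb hxb ε hε
  refine ⟨ε, hε, ?_⟩
  rintro _ ⟨t, ht, rfl⟩ hlt
  have habs : |t - xb| ≤ ε := by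
    refine le_of_lt ?_
    simpa [EuclideanSpace.norm_eq, Real.sqrt_sq_eq_abs] using hlt
  exact ⟨exS_subset_exS_add_closedBall hxb.1 habs,
    exS_subset_exS_add_closedBall ht.1 (abs_sub_comm t xb ▸ habs)⟩
end

section
/- Let Y ⊆ ℝ^p be nonempty and closed, μ a finite Borel measure on Y, X ⊆ ℝ^d, and S : X ⇉ Y a set-valued map with Borel-measurable values. If S is upper semicontinuous at x̄ ∈ X and S(x̄) is closed, then the function x ↦ μ(S(x)) is upper semicontinuous at x̄: for every ε > 0 there exists δ > 0 such that μ(S(x)) < μ(S(x̄)) + ε for all x ∈ X with ‖x−x̄‖ < δ. -/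
open MeasureTheory Filter Topology Set Pointwise
open scoped ENNReal

/-- Lemma 3.9(1): if `μ` is a finite Borel measure on `Y` and
`S : X ⇉ Y` has Borel-measurable values, is upper semicontinuous at `xb` and
`S(xb)` is closed, then `x ↦ μ(S(x))` is upper semicontinuous at `xb`. -/
theorem stmt_5 {d p : ℕ}
    (X : Set (EuclideanSpace ℝ (Fin d))) (Y : Set (EuclideanSpace ℝ (Fin p)))
    (hYne : Y.Nonempty) (hYcl : IsClosed Y)
    (μ : Measure (EuclideanSpace ℝ (Fin p))) [IsFiniteMeasure μ]
    (hμY : μ Yᶜ = 0)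
    (S : EuclideanSpace ℝ (Fin d) → Set (EuclideanSpace ℝ (Fin p)))
    (hSY : ∀ x ∈ X, S x ⊆ Y)
    (hSmeas : ∀ x ∈ X, MeasurableSet (S x))
    (xb : EuclideanSpace ℝ (Fin d)) (hxb : xb ∈ X)
    (hSxbcl : IsClosed (S xb))
    -- upper semicontinuity of `S` at `xb`
    (husc : ∀ ε > (0 : ℝ), ∃ δ > (0 : ℝ), ∀ x ∈ X, ‖x - xb‖ < δ →
      S x ⊆ S xb + Metric.closedBall 0 ε) :
    ∀ ε > (0 : ℝ), ∃ δ > (0 : ℝ), ∀ x ∈ X, ‖x - xb‖ < δ →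
      (μ (S x)).toReal < (μ (S xb)).toReal + ε := by
  intro ε hε
  have hlim : Tendsto (fun r => (μ (Metric.cthickening r (S xb))).toReal) (𝓝 0)
      (𝓝 (μ (S xb)).toReal) :=
    (ENNReal.tendsto_toReal (measure_ne_top μ _)).comp
      (tendsto_measure_cthickening_of_isClosed ⟨1, one_pos, measure_ne_top μ _⟩ hSxbcl)
  have hev := (hlim.eventually (gt_mem_nhds (lt_add_of_pos_right _ hε))).filter_mono
    (nhdsWithin_le_nhds (s := Ioi 0))
  obtain ⟨r, hr, hr0⟩ := (hev.and self_mem_nhdsWithin).exists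
  obtain ⟨δ, hδ, h⟩ := husc r hr0
  refine ⟨δ, hδ, fun x hx hxδ => lt_of_le_of_lt ?_ hr⟩
  refine ENNReal.toReal_mono (measure_ne_top μ _) (measure_mono ((h x hx hxδ).trans ?_))
  rintro _ ⟨a, ha, b, hb, rfl⟩
  refine Metric.mem_cthickening_of_dist_le _ a r _ ha ?_
  simpa [dist_eq_norm] using hb
end

section
/- Let Y ⊆ ℝ^p be nonempty and closed, μ a finite Borel measure on Y extended to a finite Borel measure on ℝ^p, X ⊆ ℝ^d, and S : X ⇉ Y a set-valued map with Borel-measurable values. Suppose S is lower semicontinuous at x̄ ∈ X, S has compact convex values on a neighborhood of x̄ in X, and μ(∂S(x̄)) = 0, where ∂S(x̄) is the topological boundary of S(x̄) in ℝ^p. Then the function x ↦ μ(S(x)) is lower semicontinuous at x̄: for every ε > 0 there exists δ > 0 such that μ(S(x̄)) ≤ μ(S(x)) + ε for all x ∈ X with ‖x−x̄‖ < δ. -/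
open MeasureTheory Filter Topology Set Pointwise
open scoped ENNReal

/-- If a closed ball of radius `r` lies within the `r`-thickening of a complete convex set `C`,
then its centre lies in `C`. -/
theorem mem_of_closedBall_subset_add_closedBall {E : Type*} [NormedAddCommGroup E]
    [InnerProductSpace ℝ E] {C : Set E} (hC : IsComplete C) (hconv : Convex ℝ C)
    {z : E} {r : ℝ} (hr : 0 ≤ r) (h : Metric.closedBall z r ⊆ C + Metric.closedBall 0 r) :
    z ∈ C := by
  obtain ⟨c₀, hc₀, -⟩ := Set.mem_add.1 (h (Metric.mem_closedBall_self hr))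
  obtain ⟨w, hw, hmin⟩ := exists_norm_eq_iInf_of_complete_convex ⟨c₀, hc₀⟩ hC hconv z
  have hproj := (norm_eq_iInf_iff_real_inner_le_zero hconv hw).1 hmin
  by_contra hz
  have hv : 0 < ‖z - w‖ := norm_pos_iff.2 (sub_ne_zero.2 fun e => hz (e ▸ hw))
  have hy : z + (r / ‖z - w‖) • (z - w) ∈ Metric.closedBall z r := by
    rw [mem_closedBall_iff_norm, add_sub_cancel_left, norm_smul, Real.norm_of_nonneg (by positivity),
      div_mul_cancel₀ _ hv.ne']
  obtain ⟨c, hc, b, hb, hcb⟩ := Set.mem_add.1 (h hy)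
  have hb' : inner ℝ (z - w) b ≤ ‖z - w‖ * r :=
    (real_inner_le_norm _ _).trans
      (mul_le_mul_of_nonneg_left (mem_closedBall_zero_iff.1 hb) (norm_nonneg _))
  have hsum : (z - w) + (r / ‖z - w‖) • (z - w) = (c - w) + b := by
    rw [sub_add_eq_add_sub, ← hcb]; abel
  have hinner := congrArg (inner ℝ (z - w)) hsum
  rw [inner_add_right, inner_add_right, real_inner_smul_right, real_inner_self_eq_norm_sq] at hinner
  have hmul : r / ‖z - w‖ * ‖z - w‖ ^ 2 = ‖z - w‖ * r := by field_simp
  nlinarith [hproj c hc, pow_pos hv 2]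

/-- Up to arbitrarily small measure, the interior of a set consists of centres of balls of a
uniform radius contained in the set. -/
theorem exists_measureReal_interior_lt_add {E : Type*}
    [PseudoMetricSpace E] [MeasurableSpace E] (μ : Measure E) [IsFiniteMeasure μ] (A : Set E)
    {ε : ℝ} (hε : 0 < ε) :
    ∃ r > (0 : ℝ), μ.real (interior A) < μ.real {z | Metric.closedBall z r ⊆ A} + ε := by
  let T : ℕ → Set E := fun n => {z | Metric.closedBall z (1 / ((n : ℝ) + 1)) ⊆ A}
  have hmono : Monotone T := fun m n hmn z hz =>
    (Metric.closedBall_subset_closedBall (Nat.one_div_le_one_div hmn)).trans hz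
  have hsub : interior A ⊆ ⋃ n, T n := by
    intro z hz
    obtain ⟨r, hr, hball⟩ := Metric.nhds_basis_closedBall.mem_iff.1 (mem_interior_iff_mem_nhds.1 hz)
    obtain ⟨n, hn⟩ := exists_nat_one_div_lt hr
    exact mem_iUnion.2 ⟨n, (Metric.closedBall_subset_closedBall hn.le).trans hball⟩
  have hlim : Tendsto (fun n => μ.real (T n)) atTop (𝓝 (μ.real (⋃ n, T n))) :=
    (ENNReal.tendsto_toReal (measure_ne_top μ _)).comp (tendsto_measure_iUnion_atTop hmono)
  have hle : μ.real (interior A) ≤ μ.real (⋃ n, T n) := measureReal_mono hsub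
  obtain ⟨n, hn⟩ := (hlim.eventually (lt_mem_nhds (sub_lt_self _ hε))).exists
  exact ⟨1 / ((n : ℝ) + 1), Nat.one_div_pos_of_nat, by linarith⟩

/-- Lemma 3.9(2): if `μ` is a finite Borel measure, `S : X ⇉ Y` has
Borel-measurable values, is lower semicontinuous at `xb`, has compact convex values
near `xb`, and `μ(∂S(xb)) = 0`, then `x ↦ μ(S(x))` is lower semicontinuous at `xb`. -/
theorem stmt_6 {d p : ℕ}
    (X : Set (EuclideanSpace ℝ (Fin d))) (Y : Set (EuclideanSpace ℝ (Fin p)))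
    (hYne : Y.Nonempty) (hYcl : IsClosed Y)
    (μ : Measure (EuclideanSpace ℝ (Fin p))) [IsFiniteMeasure μ]
    (hμY : μ Yᶜ = 0)
    (S : EuclideanSpace ℝ (Fin d) → Set (EuclideanSpace ℝ (Fin p)))
    (hSY : ∀ x ∈ X, S x ⊆ Y)
    (hSmeas : ∀ x ∈ X, MeasurableSet (S x))
    (xb : EuclideanSpace ℝ (Fin d)) (hxb : xb ∈ X)
    -- `S` has compact convex values on a neighborhood of `xb` in `X`
    (hSloc : ∀ᶠ x in 𝓝[X] xb, IsCompact (S x) ∧ Convex ℝ (S x))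
    -- the boundary of `S(xb)` is `μ`-null
    (hbd : μ (frontier (S xb)) = 0)
    -- lower semicontinuity of `S` at `xb`
    (hlsc : ∀ ε > (0 : ℝ), ∃ δ > (0 : ℝ), ∀ x ∈ X, ‖x - xb‖ < δ →
      S xb ⊆ S x + Metric.closedBall 0 ε) :
    ∀ ε > (0 : ℝ), ∃ δ > (0 : ℝ), ∀ x ∈ X, ‖x - xb‖ < δ →
      (μ (S xb)).toReal ≤ (μ (S x)).toReal + ε := by
  intro ε hε
  obtain ⟨r, hr, hlt⟩ :=
    exists_measureReal_interior_lt_add μ (S xb) hε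
  obtain ⟨δ₁, hδ₁, hS⟩ := hlsc r hr
  obtain ⟨δ₂, hδ₂, hnear⟩ := Metric.mem_nhdsWithin_iff.1 hSloc
  refine ⟨min δ₁ δ₂, lt_min hδ₁ hδ₂, fun x hx hdist => ?_⟩
  obtain ⟨hcomp, hconv⟩ :=
    hnear ⟨mem_ball_iff_norm.2 (hdist.trans_le (min_le_right _ _)), hx⟩
  have hcore : {z | Metric.closedBall z r ⊆ S xb} ⊆ S x := fun z hz =>
    mem_of_closedBall_subset_add_closedBall hcomp.isComplete hconv hr.le
      (hz.trans (hS x hx (hdist.trans_le (min_le_left _ _))))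
  have hint : μ (S xb) ≤ μ (interior (S xb)) :=
    calc μ (S xb) ≤ μ (interior (S xb) ∪ frontier (S xb)) :=
          measure_mono (subset_closure.trans (closure_eq_interior_union_frontier _).subset)
      _ ≤ μ (interior (S xb)) + μ (frontier (S xb)) := measure_union_le _ _
      _ = μ (interior (S xb)) := by rw [hbd, add_zero]
  calc (μ (S xb)).toReal ≤ μ.real (interior (S xb)) :=
        ENNReal.toReal_mono (measure_ne_top _ _) hint
    _ ≤ μ.real {z | Metric.closedBall z r ⊆ S xb} + ε := hlt.le
    _ ≤ (μ (S x)).toReal + ε := by gcongr; exact measureReal_mono hcore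
end

section
/- Let Y ⊆ ℝ^p be nonempty and closed, X ⊆ ℝ^d, and let T : X ⇉ Y be a set-valued map with nonempty convex compact values, all of the same affine dimension k, which is continuous at x̄ ∈ X. Let ρ : X × Y → [0,∞) be continuous. Then the function x ↦ ∫_{T(x)} ρ(x,y) dλ_k(y) is continuous at x̄, where λ_k is the k-dimensional Hausdorff measure on ℝ^p. -/
open MeasureTheory Filter Topology Set Pointwise
open scoped ENNReal

/-- If a ball is contained in the `ε`-thickening of a complete convex set and its radius exceeds
`ε`, then its center belongs to the convex set. -/
theorem Convex.mem_of_closedBall_subset_add {F : Type*} [NormedAddCommGroup F]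
    [InnerProductSpace ℝ F] {K : Set F} (hK : Convex ℝ K) (hKc : IsComplete K) {z : F} {η ε : ℝ}
    (hη : 0 ≤ η) (hεη : ε < η)
    (h : Metric.closedBall z η ⊆ K + Metric.closedBall 0 ε) : z ∈ K := by
  have hne : K.Nonempty := by
    obtain ⟨k, hk, -⟩ := h (Metric.mem_closedBall_self hη)
    exact ⟨k, hk⟩
  obtain ⟨n, hn, hmin⟩ := exists_norm_eq_iInf_of_complete_convex hne hKc hK z
  rw [norm_eq_iInf_iff_real_inner_le_zero hK hn] at hmin
  by_contra hz
  set g := z - n with hg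
  have hg0 : 0 < ‖g‖ := by
    rw [norm_pos_iff, hg, sub_ne_zero]
    rintro rfl
    exact hz hn
  obtain ⟨k, hk, e, he, hke⟩ := h (show z + (η / ‖g‖) • g ∈ Metric.closedBall z η by
    rw [mem_closedBall_iff_norm, add_sub_cancel_left, norm_smul,
      Real.norm_of_nonneg (by positivity)]
    field_simp
    exact le_rfl)
  rw [mem_closedBall_zero_iff] at he
  have h1 : inner ℝ g (k - n) + inner ℝ g e = ‖g‖ ^ 2 + η * ‖g‖ := by
    rw [← inner_add_right, show k - n + e = g + (η / ‖g‖) • g by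
      rw [sub_add_eq_add_sub, show k + e = _ from hke, hg]; abel]
    rw [inner_add_right, inner_smul_right, real_inner_self_eq_norm_sq]
    field_simp
  have h2 : inner ℝ g e ≤ ‖g‖ * ‖e‖ := real_inner_le_norm g e
  have h3 := hmin k hk
  nlinarith

/-- Integrals of a continuous function over compact convex sets depend continuously on the set,
with respect to the Hausdorff distance. -/
theorem tendsto_setIntegral_of_convex {F : Type*} [NormedAddCommGroup F]
    [InnerProductSpace ℝ F] [FiniteDimensional ℝ F] [MeasurableSpace F] [BorelSpace F]
    (μ : Measure F) [μ.IsAddHaarMeasure] {α : Type*} {l : Filter α} [l.IsCountablyGenerated]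
    {K : α → Set F} {C : Set F} (hC : IsCompact C) (hCc : Convex ℝ C)
    (hK : ∀ᶠ x in l, IsCompact (K x) ∧ Convex ℝ (K x))
    (hKC : ∀ ε > (0 : ℝ), ∀ᶠ x in l,
      K x ⊆ C + Metric.closedBall 0 ε ∧ C ⊆ K x + Metric.closedBall 0 ε)
    {h : F → ℝ} (hh : Continuous h) :
    Tendsto (fun x => ∫ v in K x, h v ∂μ) l (𝓝 (∫ v in C, h v ∂μ)) := by
  have hD : IsCompact (C + Metric.closedBall (0 : F) 1) := hC.add (isCompact_closedBall _ _)
  have key : Tendsto (fun x => ∫ v, (K x).indicator h v ∂μ) l (𝓝 (∫ v, C.indicator h v ∂μ)) := by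
    refine tendsto_integral_filter_of_dominated_convergence
      ((C + Metric.closedBall (0 : F) 1).indicator fun v => ‖h v‖) ?_ ?_ ?_ ?_
    · filter_upwards [hK] with x hx
      exact hh.aestronglyMeasurable.indicator hx.1.measurableSet
    · filter_upwards [hKC 1 one_pos] with x hx
      refine ae_of_all _ fun v => ?_
      rw [norm_indicator_eq_indicator_norm]
      exact indicator_le_indicator_of_subset hx.1 (fun _ => norm_nonneg _) v
    · rw [integrable_indicator_iff hD.measurableSet]
      exact hh.norm.continuousOn.integrableOn_compact hD
    · have hfr : ∀ᵐ v ∂μ, v ∉ frontier C :=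
        measure_eq_zero_iff_ae_notMem.1 (hCc.addHaar_frontier μ)
      filter_upwards [hfr] with v hv
      refine tendsto_const_nhds.congr' ?_
      by_cases hvC : v ∈ C
      · have hvi : v ∈ interior C := by
          by_contra hvi
          exact hv ⟨subset_closure hvC, hvi⟩
        obtain ⟨η, hη, hball⟩ :=
          Metric.nhds_basis_closedBall.mem_iff.1 (mem_interior_iff_mem_nhds.1 hvi)
        filter_upwards [hK, hKC (η / 2) (half_pos hη)] with x hx hx'
        have := hx.2.mem_of_closedBall_subset_add hx.1.isComplete hη.le (half_lt_self hη)
          (hball.trans hx'.2)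
        rw [indicator_of_mem hvC, indicator_of_mem this]
      · obtain ⟨η, hη, hball⟩ := Metric.nhds_basis_closedBall.mem_iff.1
          (hC.isClosed.isOpen_compl.mem_nhds hvC)
        filter_upwards [hKC η hη] with x hx
        rw [indicator_of_notMem hvC, indicator_of_notMem]
        intro hvK
        obtain ⟨c, hc, e, he, rfl⟩ := hx.1 hvK
        refine (hball ?_ : c ∈ Cᶜ) hc
        rw [mem_closedBall_zero_iff] at he
        simpa [mem_closedBall_iff_norm] using he
  rw [integral_indicator hC.measurableSet] at key
  refine key.congr' ?_
  filter_upwards [hK] with x hx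
  rw [integral_indicator hx.1.measurableSet]

/-- An affine map onto a space of the same dimension as the affine span of `A`, whose image of `A`
contains a ball of radius `r` and which has a `δ`-approximate isometric inverse on `A`, contracts
distances in `A` by at most a factor `1 + 2 * δ / r`. -/
theorem AffineMap.dist_le_of_closedBall_subset_image {E F : Type*} [NormedAddCommGroup E]
    [NormedSpace ℝ E] [FiniteDimensional ℝ E] [NormedAddCommGroup F] [NormedSpace ℝ F]
    [FiniteDimensional ℝ F] (f : E →ᵃ[ℝ] F) {g : F → E} (hg : Isometry g) {A : Set E}
    (hdim : Module.finrank ℝ (affineSpan ℝ A).direction = Module.finrank ℝ F) {m : F} {r δ : ℝ}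
    (hr : 0 < r) (hball : Metric.closedBall m r ⊆ f '' A) (hδ : ∀ y ∈ A, dist y (g (f y)) ≤ δ)
    {a b : E} (ha : a ∈ A) (hb : b ∈ A) :
    dist a b ≤ (1 + 2 * δ / r) * dist (f a) (f b) := by
  have hspan : affineSpan ℝ (f '' A) = ⊤ := by
    refine top_unique ?_
    have hi : (interior (convexHull ℝ (Metric.closedBall m r))).Nonempty := by
      rw [(convex_closedBall m r).convexHull_eq]
      exact ⟨m, mem_interior_iff_mem_nhds.2 (Metric.closedBall_mem_nhds m hr)⟩
    rw [← affineSpan_eq_top_of_nonempty_interior hi]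
    exact affineSpan_mono ℝ hball
  have hinj : Function.Injective (f.linear.domRestrict (affineSpan ℝ A).direction) := by
    rw [LinearMap.injective_iff_surjective_of_finrank_eq_finrank hdim, ← LinearMap.range_eq_top,
      LinearMap.range_domRestrict, ← AffineSubspace.map_direction, AffineSubspace.map_span, hspan,
      AffineSubspace.direction_top]
  have hsub : ∀ {x y : E}, x ∈ A → y ∈ A → x - y ∈ (affineSpan ℝ A).direction := fun hx hy =>
    AffineSubspace.vsub_mem_direction (subset_affineSpan ℝ A hx) (subset_affineSpan ℝ A hy)
  have hlin : ∀ x y : E, f.linear (x - y) = f x - f y := fun x y => f.linearMap_vsub x y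
  set u := f a - f b with hu
  by_cases hu0 : u = 0
  · have : (⟨a - b, hsub ha hb⟩ : (affineSpan ℝ A).direction) = 0 := by
      apply hinj
      simp [hlin, ← hu, hu0]
    have hab : a = b := sub_eq_zero.1 (congrArg Subtype.val this)
    simp [hab]
  have hupos : 0 < ‖u‖ := norm_pos_iff.2 hu0
  obtain ⟨t, ht⟩ : ∃ t, t = r / ‖u‖ := ⟨_, rfl⟩
  have htpos : 0 < t := by rw [ht]; positivity
  have htu : ‖t • u‖ = r := by
    rw [norm_smul, Real.norm_of_nonneg htpos.le, ht]
    field_simp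
  obtain ⟨c, hc, hcm⟩ := hball (Metric.mem_closedBall_self hr.le)
  obtain ⟨e, he, hem⟩ := hball (show m + t • u ∈ Metric.closedBall m r by
    rw [mem_closedBall_iff_norm, add_sub_cancel_left, htu])
  have hec : e - c = t • (a - b) := by
    have : (⟨e - c, hsub he hc⟩ : (affineSpan ℝ A).direction) = t • ⟨a - b, hsub ha hb⟩ := by
      apply hinj
      simp only [map_smul, LinearMap.domRestrict_apply, hlin, ← hu]
      rw [hem, hcm, add_sub_cancel_left]
    exact congrArg Subtype.val this
  have h1 : dist e c ≤ δ + r + δ := by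
    calc dist e c ≤ dist e (g (f e)) + dist (g (f e)) (g (f c)) + dist (g (f c)) c :=
          dist_triangle4 _ _ _ _
      _ ≤ δ + r + δ := by
          gcongr
          · exact hδ e he
          · rw [hg.dist_eq, hem, hcm, dist_eq_norm, add_sub_cancel_left, htu]
          · rw [dist_comm]; exact hδ c hc
  rw [dist_eq_norm, hec, norm_smul, Real.norm_of_nonneg htpos.le, ht] at h1
  rw [dist_eq_norm, dist_eq_norm, ← hu]
  calc ‖a - b‖ = (r / ‖u‖ * ‖a - b‖) * (‖u‖ / r) := by field_simp
    _ ≤ (δ + r + δ) * (‖u‖ / r) := by gcongr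
    _ = _ := by field_simp; ring

/-- Comparison of Hausdorff measures under a `1`-Lipschitz map with `L`-Lipschitz inverse. -/
theorem hausdorffMeasure_image_le_map_restrict_le {E F : Type*} [MetricSpace E]
    [MeasurableSpace E] [BorelSpace E] [MetricSpace F] [MeasurableSpace F] [BorelSpace F]
    {f : E → F} (hf : LipschitzWith 1 f) {A : Set E} (hA : MeasurableSet A)
    (hfA : MeasurableSet (f '' A)) {L : NNReal}
    (hL : ∀ a ∈ A, ∀ b ∈ A, dist a b ≤ L * dist (f a) (f b)) {k : ℝ} (hk : 0 ≤ k) :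
    (μH[k] : Measure F).restrict (f '' A) ≤ ((μH[k] : Measure E).restrict A).map f ∧
      ((μH[k] : Measure E).restrict A).map f ≤
        ((L : ℝ≥0∞) ^ k) • (μH[k] : Measure F).restrict (f '' A) := by
  have hfm : Measurable f := hf.continuous.measurable
  constructor <;> refine Measure.le_iff.2 fun D hD => ?_
  · rw [Measure.map_apply hfm hD, Measure.restrict_apply hD, Measure.restrict_apply (hfm hD)]
    have := hf.hausdorffMeasure_image_le hk (f ⁻¹' D ∩ A)
    rwa [ENNReal.coe_one, ENNReal.one_rpow, one_mul, image_preimage_inter] at this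
  · rw [Measure.map_apply hfm hD, Measure.smul_apply, Measure.restrict_apply hD,
      Measure.restrict_apply (hfm hD), smul_eq_mul]
    rcases A.eq_empty_or_nonempty with rfl | ⟨a₀, -⟩
    · simp
    have : Nonempty E := ⟨a₀⟩
    have hinj : InjOn f A := fun a ha b hb hab => by
      have := hL a ha b hb
      rw [hab, dist_self, mul_zero] at this
      exact dist_le_zero.1 this
    have hs : LipschitzOnWith L (Function.invFunOn f A) (D ∩ f '' A) := by
      refine LipschitzOnWith.of_dist_le_mul ?_
      rintro _ ⟨-, a, ha, rfl⟩ _ ⟨-, b, hb, rfl⟩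
      rw [hinj.leftInvOn_invFunOn ha, hinj.leftInvOn_invFunOn hb]
      exact hL a ha b hb
    have := hs.hausdorffMeasure_image_le hk
    refine le_trans (measure_mono ?_) this
    rintro a ⟨haD, haA⟩
    exact ⟨f a, ⟨haD, a, haA, rfl⟩, hinj.leftInvOn_invFunOn haA⟩

/-- Comparison of integrals under a `1`-Lipschitz map with `L`-Lipschitz inverse. -/
theorem setIntegral_comp_hausdorffMeasure_bounds {E F : Type*} [MetricSpace E]
    [MeasurableSpace E] [BorelSpace E] [MetricSpace F] [MeasurableSpace F] [BorelSpace F]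
    [SecondCountableTopology F]
    {f : E → F} (hf : LipschitzWith 1 f) {A : Set E} (hA : IsCompact A) {L : NNReal}
    (hL : ∀ a ∈ A, ∀ b ∈ A, dist a b ≤ L * dist (f a) (f b)) {k : ℝ} (hk : 0 ≤ k)
    [IsFiniteMeasureOnCompacts (μH[k] : Measure F)] :
    (μH[k] : Measure E) A ≤ (L : ℝ≥0∞) ^ k * (μH[k] : Measure F) (f '' A) ∧
    ∀ h : F → ℝ, Continuous h → (∀ v, 0 ≤ h v) →
      ∫ v in f '' A, h v ∂(μH[k] : Measure F) ≤ ∫ y in A, h (f y) ∂(μH[k] : Measure E) ∧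
      ∫ y in A, h (f y) ∂(μH[k] : Measure E) ≤
        (L : ℝ) ^ k * ∫ v in f '' A, h v ∂(μH[k] : Measure F) := by
  have hfA : IsCompact (f '' A) := hA.image hf.continuous
  obtain ⟨h1, h2⟩ := hausdorffMeasure_image_le_map_restrict_le hf hA.measurableSet
    hfA.measurableSet hL hk
  have hfm : Measurable f := hf.continuous.measurable
  refine ⟨?_, fun h hh h0 => ?_⟩
  · have := h2 univ
    rwa [Measure.map_apply hfm MeasurableSet.univ, Measure.smul_apply, preimage_univ,
      Measure.restrict_apply_univ, Measure.restrict_apply_univ, smul_eq_mul] at this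
  · have hint : Integrable h (((L : ℝ≥0∞) ^ k) • (μH[k] : Measure F).restrict (f '' A)) :=
      Integrable.smul_measure (hh.continuousOn.integrableOn_compact hfA)
        (ENNReal.rpow_ne_top_of_nonneg hk ENNReal.coe_ne_top)
    have hmap := integral_map (μ := (μH[k] : Measure E).restrict A) hfm.aemeasurable
      (f := h) hh.aestronglyMeasurable
    rw [← hmap]
    refine ⟨integral_mono_measure h1 (ae_of_all _ h0) (hint.mono_measure h2), ?_⟩
    have := integral_mono_measure h2 (ae_of_all _ h0) hint
    rwa [integral_smul_measure, ← ENNReal.toReal_rpow, ENNReal.coe_toReal, smul_eq_mul] at this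

/-- Orthogonal projection onto the affine hull of `C`, in coordinates given by its direction. -/
theorem exists_affine_chart {E : Type*} [NormedAddCommGroup E] [InnerProductSpace ℝ E]
    [FiniteDimensional ℝ E] {C : Set E} (hC : C.Nonempty)
    {V : Submodule ℝ E} (hV : V = (affineSpan ℝ C).direction) :
    ∃ (f : E →ᵃ[ℝ] V) (g : V → E),
      Isometry g ∧ LipschitzWith 1 f ∧ (∀ v, f (g v) = v) ∧ (∀ c ∈ C, g (f c) = c) ∧
      ∀ v, g v ∈ affineSpan ℝ C := by
  obtain ⟨c₀, hc₀⟩ := hC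
  subst hV
  let V := (affineSpan ℝ C).direction
  have hf : ∀ y, (V.orthogonalProjectionOnto.toLinearMap.toAffineMap.comp
      (AffineMap.id ℝ E - AffineMap.const ℝ E c₀)) y = V.orthogonalProjectionOnto (y - c₀) :=
    fun _ => rfl
  refine ⟨V.orthogonalProjectionOnto.toLinearMap.toAffineMap.comp
    (AffineMap.id ℝ E - AffineMap.const ℝ E c₀), fun v => v + c₀, ?_, ?_, ?_, ?_, ?_⟩
  · exact Isometry.of_dist_eq fun v w => by rw [dist_add_right]; rfl
  · refine LipschitzWith.of_dist_le_mul fun x y => ?_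
    rw [hf, hf, dist_eq_norm, ← map_sub, sub_sub_sub_cancel_right, NNReal.coe_one, one_mul,
      dist_eq_norm]
    exact V.norm_orthogonalProjectionOnto_apply_le _
  · intro v
    rw [hf, add_sub_cancel_right, Submodule.orthogonalProjectionOnto_mem_subspace_eq_self]
  · intro c hc
    have hmem : c - c₀ ∈ V := AffineSubspace.vsub_mem_direction (subset_affineSpan ℝ C hc)
      (subset_affineSpan ℝ C hc₀)
    have := V.orthogonalProjectionOnto_mem_subspace_eq_self ⟨c - c₀, hmem⟩
    rw [hf, this]
    exact sub_add_cancel c c₀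
  · intro v
    exact AffineSubspace.vadd_mem_of_mem_direction v.2 (subset_affineSpan ℝ C hc₀)

/-- Lemma 3.11: if `T : X ⇉ Y` has nonempty convex compact values of
constant affine dimension `k` and is continuous at `xb`, and `ρ ≥ 0` is continuous,
then `x ↦ ∫_{T(x)} ρ(x,y) dλ_k(y)` is continuous at `xb`, where `λ_k` is the
`k`-dimensional Hausdorff measure. -/
theorem stmt_9 {d p : ℕ}
    (X : Set (EuclideanSpace ℝ (Fin d))) (Y : Set (EuclideanSpace ℝ (Fin p)))
    (hYne : Y.Nonempty) (hYcl : IsClosed Y)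
    (T : EuclideanSpace ℝ (Fin d) → Set (EuclideanSpace ℝ (Fin p)))
    (hTY : ∀ x ∈ X, T x ⊆ Y)
    (hTne : ∀ x ∈ X, (T x).Nonempty)
    (hTconv : ∀ x ∈ X, Convex ℝ (T x))
    (hTcomp : ∀ x ∈ X, IsCompact (T x))
    (k : ℕ) (hTdim : ∀ x ∈ X, adim (T x) = k)
    (xb : EuclideanSpace ℝ (Fin d)) (hxb : xb ∈ X)
    (hTcont : SVContinuousAt X T xb)
    (ρ : EuclideanSpace ℝ (Fin d) → EuclideanSpace ℝ (Fin p) → ℝ)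
    (hρnn : ∀ x y, 0 ≤ ρ x y)
    (hρcont : Continuous (fun q : EuclideanSpace ℝ (Fin d) × EuclideanSpace ℝ (Fin p) =>
      ρ q.1 q.2)) :
    ContinuousWithinAt
      (fun x => ∫ y in T x, ρ x y ∂(μH[(k : ℝ)] : Measure (EuclideanSpace ℝ (Fin p)))) X xb := by
  have hC : IsCompact (T xb) := hTcomp xb hxb
  set C := T xb with hCdef
  obtain ⟨V, hV⟩ : ∃ V, V = (affineSpan ℝ C).direction := ⟨_, rfl⟩
  obtain ⟨f, g, hg, hf, hfg, hgf, hgC⟩ := exists_affine_chart (hTne xb hxb) hV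
  have hk : Module.finrank ℝ V = k := by
    rw [hV]
    exact hTdim xb hxb
  have hk0 : (0 : ℝ) ≤ k := k.cast_nonneg
  have : (μH[(k : ℝ)] : Measure V).IsAddHaarMeasure := by
    rw [← hk]
    exact isAddHaarMeasure_hausdorffMeasure
  have hfc : Continuous f := hf.continuous
  have hnear : ∀ ε > (0 : ℝ), ∀ᶠ x in 𝓝[X] xb, x ∈ X ∧
      T x ⊆ C + Metric.closedBall 0 ε ∧ C ⊆ T x + Metric.closedBall 0 ε := by
    intro ε hε
    obtain ⟨δ, hδ, h⟩ := hTcont ε hε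
    filter_upwards [self_mem_nhdsWithin, mem_nhdsWithin_of_mem_nhds (Metric.ball_mem_nhds xb hδ)]
      with x hx hxδ
    exact ⟨hx, h x hx (mem_ball_iff_norm.1 hxδ)⟩
  have himage : ∀ {ε : ℝ} {A B : Set (EuclideanSpace ℝ (Fin p))},
      A ⊆ B + Metric.closedBall 0 ε → f '' A ⊆ f '' B + Metric.closedBall 0 ε := by
    rintro ε A B hAB _ ⟨a, ha, rfl⟩
    obtain ⟨b, hb, e, he, rfl⟩ := hAB ha
    refine ⟨f b, ⟨b, hb, rfl⟩, f (b + e) - f b, ?_, add_sub_cancel _ _⟩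
    rw [mem_closedBall_zero_iff] at he ⊢
    have := hf.dist_le_mul (b + e) b
    rw [dist_eq_norm, dist_eq_norm, add_sub_cancel_left, NNReal.coe_one, one_mul] at this
    exact this.trans he
  have hK : ∀ᶠ x in 𝓝[X] xb, IsCompact (f '' T x) ∧ Convex ℝ (f '' T x) := by
    filter_upwards [self_mem_nhdsWithin] with x hx
    exact ⟨(hTcomp x hx).image hfc, (hTconv x hx).affine_image f⟩
  have hKC : ∀ ε > (0 : ℝ), ∀ᶠ x in 𝓝[X] xb, f '' T x ⊆ f '' C + Metric.closedBall 0 ε ∧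
      f '' C ⊆ f '' T x + Metric.closedBall 0 ε := by
    intro ε hε
    filter_upwards [hnear ε hε] with x hx
    exact ⟨himage hx.2.1, himage hx.2.2⟩
  have hfC : IsCompact (f '' C) := hC.image hfc
  have hfCc : Convex ℝ (f '' C) := (hTconv xb hxb).affine_image f
  obtain ⟨m, r, hr, hball⟩ : ∃ m : V, ∃ r > 0, Metric.closedBall m (2 * r) ⊆ f '' C := by
    have hi : (interior (f '' C)).Nonempty := by
      rw [hfCc.interior_nonempty_iff_affineSpan_eq_top, ← AffineSubspace.map_span]
      exact top_unique fun v _ => ⟨g v, hgC v, hfg v⟩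
    obtain ⟨m, hm⟩ := hi
    obtain ⟨r, hr, h⟩ := Metric.nhds_basis_closedBall.mem_iff.1 (mem_interior_iff_mem_nhds.1 hm)
    exact ⟨m, r / 2, half_pos hr, by rwa [mul_div_cancel₀ r two_ne_zero]⟩
  have hballx : ∀ᶠ x in 𝓝[X] xb, Metric.closedBall m r ⊆ f '' T x := by
    filter_upwards [hK, hKC (r / 2) (half_pos hr)] with x hx hx' z hz
    refine hx.2.mem_of_closedBall_subset_add hx.1.isComplete hr.le (half_lt_self hr)
      (Subset.trans (Metric.closedBall_subset_closedBall' ?_) (hball.trans hx'.2))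
    rw [Metric.mem_closedBall] at hz
    linarith
  have hdist : ∀ ε > (0 : ℝ), ∀ᶠ x in 𝓝[X] xb, ∀ y ∈ T x, dist y (g (f y)) ≤ ε := by
    intro ε hε
    filter_upwards [hnear (ε / 2) (half_pos hε)] with x hx y hy
    obtain ⟨c, hc, e, he, rfl⟩ := hx.2.1 hy
    have h1 : dist (c + e) c ≤ ε / 2 := by
      rwa [dist_eq_norm, add_sub_cancel_left, ← mem_closedBall_zero_iff]
    have h2 : dist c (g (f (c + e))) ≤ ε / 2 := by
      nth_rewrite 1 [← hgf c hc]
      rw [hg.dist_eq, dist_comm]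
      simpa using (hf.dist_le_mul (c + e) c).trans (by simpa using h1)
    exact (dist_triangle _ c _).trans (by linarith)
  have hlip : ∀ L : NNReal, 1 < L → ∀ᶠ x in 𝓝[X] xb, ∀ a ∈ T x, ∀ b ∈ T x,
      dist a b ≤ L * dist (f a) (f b) := by
    intro L hL
    have hL' : (0 : ℝ) < L - 1 := sub_pos.2 (by exact_mod_cast hL)
    filter_upwards [self_mem_nhdsWithin, hballx, hdist ((L - 1) * r / 2) (by positivity)]
      with x hx hxb' hxd a ha b hb
    have hdim : Module.finrank ℝ (affineSpan ℝ (T x)).direction = Module.finrank ℝ V :=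
      (hTdim x hx).trans hk.symm
    refine (f.dist_le_of_closedBall_subset_image hg hdim hr hxb' hxd ha hb).trans_eq ?_
    congr 1
    field_simp
    ring
  set h : V → ℝ := fun v => ρ xb (g v) with hh
  have hhc : Continuous h := hρcont.comp (continuous_const.prodMk hg.continuous)
  have hh0 : ∀ v, 0 ≤ h v := fun v => hρnn _ _
  have hI := tendsto_setIntegral_of_convex (μH[(k : ℝ)] : Measure V) hfC hfCc hK hKC hhc
  set I₀ := ∫ v in f '' C, h v ∂(μH[(k : ℝ)] : Measure V) with hI₀
  have hxbI : ∫ y in T xb, ρ xb y ∂(μH[(k : ℝ)] : Measure (EuclideanSpace ℝ (Fin p))) = I₀ := by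
    have h1 : ∀ a ∈ C, ∀ b ∈ C, dist a b ≤ (1 : NNReal) * dist (f a) (f b) := by
      intro a ha b hb
      rw [NNReal.coe_one, one_mul, ← hg.dist_eq, hgf a ha, hgf b hb]
    obtain ⟨h2, h3⟩ := (setIntegral_comp_hausdorffMeasure_bounds hf hC h1 hk0).2 h hhc hh0
    rw [NNReal.coe_one, Real.one_rpow, one_mul] at h3
    refine Eq.trans (setIntegral_congr_fun hC.measurableSet fun y hy => ?_) (le_antisymm h3 h2)
    simp only [hh, hgf y hy]
  have hJ : Tendsto (fun x => ∫ y in T x, h (f y)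
      ∂(μH[(k : ℝ)] : Measure (EuclideanSpace ℝ (Fin p)))) (𝓝[X] xb) (𝓝 I₀) := by
    refine tendsto_order.2 ⟨fun a ha => ?_, fun a ha => ?_⟩
    · filter_upwards [self_mem_nhdsWithin, hI.eventually_const_lt ha, hlip 2 one_lt_two]
        with x hx hxa hxL
      exact hxa.trans_le
        ((setIntegral_comp_hausdorffMeasure_bounds hf (hTcomp x hx) hxL hk0).2 h hhc hh0).1
    · obtain ⟨L, hL, hLa⟩ : ∃ L : NNReal, 1 < L ∧ (L : ℝ) ^ (k : ℝ) * I₀ < a := by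
        have hcont : Tendsto (fun L : NNReal => (L : ℝ) ^ (k : ℝ) * I₀) (𝓝[>] 1) (𝓝 I₀) := by
          have : Continuous fun L : NNReal => (L : ℝ) ^ (k : ℝ) * I₀ :=
            ((Real.continuous_rpow_const hk0).comp NNReal.continuous_coe).mul continuous_const
          simpa using (this.tendsto 1).mono_left nhdsWithin_le_nhds
        exact ((eventually_mem_nhdsWithin).and (hcont.eventually_lt_const ha)).exists
      filter_upwards [self_mem_nhdsWithin,
        (hI.const_mul ((L : ℝ) ^ (k : ℝ))).eventually_lt_const hLa, hlip L hL] with x hx hxa hxL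
      exact lt_of_le_of_lt
        ((setIntegral_comp_hausdorffMeasure_bounds hf (hTcomp x hx) hxL hk0).2 h hhc hh0).2 hxa
  have hunif : ∀ η > (0 : ℝ), ∀ᶠ x in 𝓝[X] xb, ∀ y ∈ T x, ‖ρ x y - h (f y)‖ ≤ η := by
    intro η hη
    obtain ⟨R, hR⟩ := hC.isBounded.subset_closedBall 0
    have hu := ((isCompact_closedBall xb 1).prod
      (isCompact_closedBall (0 : EuclideanSpace ℝ (Fin p)) (R + 2))).uniformContinuousOn_of_continuous
      hρcont.continuousOn
    obtain ⟨δ, hδ, hu⟩ := Metric.uniformContinuousOn_iff.1 hu η hη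
    filter_upwards [hnear 1 one_pos, hdist 1 one_pos, hdist (δ / 2) (half_pos hδ),
      mem_nhdsWithin_of_mem_nhds (Metric.ball_mem_nhds xb hδ),
      mem_nhdsWithin_of_mem_nhds (Metric.ball_mem_nhds xb one_pos)] with x hx h1 hd hxδ hx1 y hy
    have hy1 : ‖y‖ ≤ R + 1 := by
      obtain ⟨c, hc, e, he, rfl⟩ := hx.2.1 hy
      have := mem_closedBall_zero_iff.1 (hR hc)
      rw [mem_closedBall_zero_iff] at he
      exact (norm_add_le _ _).trans (by linarith)
    have hgy : ‖g (f y)‖ ≤ R + 2 := by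
      have h2 := h1 y hy
      rw [dist_comm, dist_eq_norm] at h2
      have := norm_le_norm_add_norm_sub' (g (f y)) y
      linarith
    have := hu (x, y) ⟨(Metric.ball_subset_closedBall hx1), by
        rw [mem_closedBall_zero_iff]; linarith⟩ (xb, g (f y))
      ⟨Metric.mem_closedBall_self zero_le_one, by rwa [mem_closedBall_zero_iff]⟩ (by
        rw [Prod.dist_eq]
        exact max_lt hxδ ((hd y hy).trans_lt (half_lt_self hδ)))
    rw [dist_eq_norm] at this
    exact this.le
  obtain ⟨M, hM⟩ : ∃ M : NNReal, ∀ᶠ x in 𝓝[X] xb,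
      (μH[(k : ℝ)] : Measure (EuclideanSpace ℝ (Fin p))) (T x) ≤ M := by
    have hD : IsCompact (f '' C + Metric.closedBall (0 : V) 1) := hfC.add (isCompact_closedBall _ _)
    have hfin : ((2 : NNReal) : ℝ≥0∞) ^ (k : ℝ) *
        (μH[(k : ℝ)] : Measure V) (f '' C + Metric.closedBall (0 : V) 1) ≠ ⊤ :=
      ENNReal.mul_ne_top (ENNReal.rpow_ne_top_of_nonneg hk0 ENNReal.coe_ne_top) hD.measure_ne_top
    obtain ⟨M, hM⟩ := WithTop.ne_top_iff_exists.1 hfin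
    refine ⟨M, ?_⟩
    change (M : ℝ≥0∞) = _ at hM
    rw [hM]
    filter_upwards [self_mem_nhdsWithin, hKC 1 one_pos, hlip 2 one_lt_two] with x hx hx1 hxL
    refine (setIntegral_comp_hausdorffMeasure_bounds hf (hTcomp x hx) hxL hk0).1.trans ?_
    gcongr
    exact hx1.1
  have hFJ : Tendsto (fun x => (∫ y in T x, ρ x y
      ∂(μH[(k : ℝ)] : Measure (EuclideanSpace ℝ (Fin p)))) - ∫ y in T x, h (f y)
      ∂(μH[(k : ℝ)] : Measure (EuclideanSpace ℝ (Fin p)))) (𝓝[X] xb) (𝓝 0) := by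
    rw [Metric.tendsto_nhds]
    intro ε hε
    filter_upwards [self_mem_nhdsWithin, hM, hunif (ε / (M + 1)) (by positivity)] with x hx hxM hxu
    have hfin : (μH[(k : ℝ)] : Measure (EuclideanSpace ℝ (Fin p))) (T x) < ⊤ :=
      hxM.trans_lt ENNReal.coe_lt_top
    have hint : ∀ u : EuclideanSpace ℝ (Fin p) → ℝ, Continuous u →
        IntegrableOn u (T x) (μH[(k : ℝ)]) := by
      intro u hu
      obtain ⟨B, hB⟩ := (hTcomp x hx).exists_bound_of_continuousOn hu.continuousOn
      exact Measure.integrableOn_of_bounded hfin.ne hu.aestronglyMeasurable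
        (ae_restrict_of_forall_mem (hTcomp x hx).measurableSet hB)
    have hρx : Continuous (ρ x) := hρcont.comp (continuous_const.prodMk continuous_id)
    have hhf : Continuous fun y => h (f y) := hhc.comp hfc
    rw [dist_zero_right, ← integral_sub (hint _ hρx) (hint _ hhf)]
    refine (norm_setIntegral_le_of_norm_le_const hfin hxu).trans_lt ?_
    have hreal : (μH[(k : ℝ)] : Measure (EuclideanSpace ℝ (Fin p))).real (T x) ≤ M :=
      ENNReal.toReal_le_coe_of_le_coe hxM
    calc _ ≤ ε / (M + 1) * M := by gcongr
      _ < ε / (M + 1) * (M + 1) := by gcongr; exact lt_add_one _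
      _ = ε := by field_simp
  rw [ContinuousWithinAt, hxbI]
  simpa using hFJ.add hJ
end
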